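/- arXiv:1011.5883 — 4 statements merged into one kernel-verified Lean document; each statement's English description precedes it below -/
import Mathlib

section
/- For every m ≥ 1, a set M of edges of CGG(2m) is a co-blocker if and only if M is a semi-simple perfect matching. -/
/-- The vertex set of the complete convex geometric graph `CGG(2m)`:
the vertices are labelled cyclically by `0, 1, …, 2m-1`. -/
abbrev Vtx (m : ℕ) := ZMod (2 * m)

/-- The order of an edge `{i,j}` of `CGG(2m)`: `min (|i-j|, 2m - |i-j|)`. -/
def edgeOrder (m : ℕ) : Sym2 (Vtx m) → ℕ :=
  Sym2.lift ⟨fun i j => min (i - j).val (j - i).val, fun i j => min_comm _ _⟩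

/-- The direction of an edge `{i,j}` of `CGG(2m)`: `i + j (mod 2m)`. -/
def edgeDir (m : ℕ) : Sym2 (Vtx m) → Vtx m :=
  Sym2.lift ⟨fun i j => i + j, fun i j => add_comm i j⟩

/-- `x` lies on the open cyclic arc from `a` to `b`, taken counterclockwise. -/
def InArc (m : ℕ) (a b x : Vtx m) : Prop :=
  0 < (x - a).val ∧ (x - a).val < (b - a).val

/-- Two edges of `CGG(2m)` cross: their endpoints interleave in the cyclic order,
i.e. writing them as `{a,b}` and `{c,d}`, exactly one of `c, d` lies on the open
cyclic arc from `a` to `b` taken counterclockwise. -/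
def Crosses (m : ℕ) (e f : Sym2 (Vtx m)) : Prop :=
  ∃ a b c d : Vtx m, e = s(a, b) ∧ f = s(c, d) ∧
    Xor' (InArc m a b c) (InArc m a b d)

/-- Two edges of `CGG(2m)` are neighbors: some endpoint of one differs by `±1`
(mod `2m`) from some endpoint of the other. -/
def Neighbors (m : ℕ) (e f : Sym2 (Vtx m)) : Prop :=
  ∃ x ∈ e, ∃ y ∈ f, x = y + 1 ∨ y = x + 1

/-- `M` is a perfect matching of `CGG(2m)`: a set of pairwise vertex-disjoint
edges covering all `2m` vertices. -/
def IsPM (m : ℕ) (M : Finset (Sym2 (Vtx m))) : Prop :=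
  (∀ e ∈ M, ¬ e.IsDiag) ∧
  (∀ e ∈ M, ∀ f ∈ M, e ≠ f → ∀ x : Vtx m, x ∈ e → x ∉ f) ∧
  (∀ x : Vtx m, ∃ e ∈ M, x ∈ e)

/-- `M` is a simple perfect matching (SPM) of `CGG(2m)`: a perfect matching
no two of whose edges cross. -/
def IsSPM (m : ℕ) (M : Finset (Sym2 (Vtx m))) : Prop :=
  IsPM m M ∧ ∀ e ∈ M, ∀ f ∈ M, e ≠ f → ¬ Crosses m e f

/-- `M` is a semi-simple perfect matching of `CGG(2m)`: a perfect matching all of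
whose edges have odd order, and no two neighboring edges of which cross. -/
def IsSemiSimple (m : ℕ) (M : Finset (Sym2 (Vtx m))) : Prop :=
  IsPM m M ∧ (∀ e ∈ M, Odd (edgeOrder m e)) ∧
  ∀ e ∈ M, ∀ f ∈ M, e ≠ f → Neighbors m e f → ¬ Crosses m e f

/-- `B` is a set of edges of `CGG(2m)` that meets every member of the family `F`,
of minimum cardinality among all sets of edges meeting every member of `F`. -/
def MinTransversal (m : ℕ) (F : Set (Finset (Sym2 (Vtx m))))
    (B : Finset (Sym2 (Vtx m))) : Prop :=
  (∀ e ∈ B, ¬ e.IsDiag) ∧ (∀ M ∈ F, (B ∩ M).Nonempty) ∧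
  ∀ B' : Finset (Sym2 (Vtx m)), (∀ e ∈ B', ¬ e.IsDiag) →
    (∀ M ∈ F, (B' ∩ M).Nonempty) → B.card ≤ B'.card

/-- `B` is a blocker of `CGG(2m)`: a set of edges meeting every SPM, of minimum
cardinality among all sets of edges meeting every SPM. -/
def IsBlocker (m : ℕ) (B : Finset (Sym2 (Vtx m))) : Prop :=
  MinTransversal m {M | IsSPM m M} B

/-- `C` is a co-blocker of `CGG(2m)`: a set of edges meeting every blocker, of
minimum cardinality among all sets of edges meeting every blocker. -/
def IsCoBlocker (m : ℕ) (C : Finset (Sym2 (Vtx m))) : Prop :=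
  MinTransversal m {B | IsBlocker m B} C

/-- Between two zeros of `R` at distance less than `m` there are only zeros. -/
lemma rotation_zero_convex {m : ℤ} {R : ℤ → ℤ}
    (hanti : ∀ k, R (k + m) = m - 1 - R k)
    (hstep : ∀ i L, 0 ≤ L → L < m → R i = 0 ∨ R (i - L - 1) < L ∨ L < R (i - L))
    {a a' c : ℤ} (ha : R a = 0) (ha' : R a' = 0) (hac : a < c) (hca : c < a')
    (hlt : a' - a < m) : R c = 0 := by
  by_contra hc
  have hprop : ∀ j : ℕ, a' - m + j < c → c - (a' - m + 1 + j) + 1 ≤ R (a' - m + 1 + j) := by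
    intro j
    induction j with
    | zero =>
      intro hj
      have h1 := hanti (a' - m)
      rw [sub_add_cancel, ha'] at h1
      have h2 := hstep c (c - (a' - m + 1)) (by push_cast at hj; omega) (by omega)
      rw [show c - (c - (a' - m + 1)) - 1 = a' - m by ring,
        show c - (c - (a' - m + 1)) = a' - m + 1 by ring] at h2
      simp only [Nat.cast_zero, add_zero]
      omega
    | succ j ih =>
      intro hj
      push_cast at hj ⊢
      have h1 := ih (by omega)
      have h2 := hstep c (c - (a' - m + 1 + (j + 1))) (by omega) (by omega)
      rw [show c - (c - (a' - m + 1 + ((j : ℤ) + 1))) - 1 = a' - m + 1 + j by ring,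
        show c - (c - (a' - m + 1 + ((j : ℤ) + 1))) = a' - m + 1 + (j + 1) by ring] at h2
      omega
  have h := hprop (a - (a' - m + 1)).toNat (by omega)
  rw [Int.toNat_of_nonneg (by omega), show a' - m + 1 + (a - (a' - m + 1)) = a by ring] at h
  omega

/-- The combinatorial core. The number `R k` describes the unique edge
`{k - R k, k + 1 + R k}` of direction `2k + 1` of a blocker, and `s x` describes the edge
`{x, x + 1 + 2 s x}` at `x` of a matching whose consecutive edges do not cross.
Such a matching shares an edge with the blocker. -/
lemma exists_rotation_eq {m : ℤ} (hm : 2 ≤ m) {R s : ℤ → ℤ}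
    (hR0 : ∀ k, 0 ≤ R k) (hanti : ∀ k, R (k + m) = m - 1 - R k)
    (hstep : ∀ i L, 0 ≤ L → L < m → R i = 0 ∨ R (i - L - 1) < L ∨ L < R (i - L))
    (hs0 : ∀ x, 0 ≤ s x) (hsm : ∀ x, s x < m)
    (hcross : ∀ x, 1 ≤ s x → s x ≤ s (x + 1) → s (x + 1) = m - 1) :
    ∃ x, R (x + s x) = s x := by
  by_contra! hne
  have hRm : ∀ k, R k ≤ m - 1 := fun k => by
    have h1 := hanti k
    have h2 := hR0 (k + m)
    omega
  have hper : ∀ k, R (k + 2 * m) = R k := fun k => by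
    have h1 := hanti k
    have h2 := hanti (k + m)
    rw [show k + m + m = k + 2 * m by ring] at h2
    omega
  have hsucc : ∀ k, R (k + 1 + R k) = 0 ∨ R k < R (k + 1) := fun k => by
    have h := hstep (k + 1 + R k) (R k) (hR0 k) (by have := hRm k; omega)
    rw [show k + 1 + R k - R k - 1 = k by ring, show k + 1 + R k - R k = k + 1 by ring] at h
    omega
  have hsucc' : ∀ k, R (k - R k) = 0 ∨ R (k + 1) < R k := fun k => by
    have h := hsucc (k + m)
    have h1 := hanti k
    have h2 := hanti (k + 1)
    have h3 := hper (k - R k)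
    rw [h1, show k + m + 1 + (m - 1 - R k) = k - R k + 2 * m by ring, h3,
      show k + m + 1 = k + 1 + m by ring] at h
    omega
  have hpred : ∀ k, R (k + R k) = 0 ∨ R (k - 1) < R k := fun k => by
    have h := hstep (k + R k) (R k) (hR0 k) (by have := hRm k; omega)
    rw [show k + R k - R k - 1 = k - 1 by ring, show k + R k - R k = k by ring] at h
    omega
  have hpred' : ∀ k, R (k - R k - 1) = 0 ∨ R k < R (k - 1) := fun k => by
    have h := hpred (k + m)
    have h1 := hanti k
    have h2 := hanti (k - 1)
    have h3 := hper (k - R k - 1)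
    rw [h1, show k + m + (m - 1 - R k) = k - R k - 1 + 2 * m by ring, h3,
      show k + m - 1 = k - 1 + m by ring] at h
    omega
  obtain ⟨z, hz⟩ : ∃ z, R z = 0 := by
    have h1 := hsucc 0
    have h2 := hsucc' 0
    by_contra! h
    have h3 := h (0 + 1 + R 0)
    have h4 := h (0 - R 0)
    omega
  obtain ⟨v, hv, hv'⟩ : ∃ v, R v = 0 ∧ R (v - 1) ≠ 0 := by
    by_contra! h
    have hall : ∀ j : ℕ, R (z - j) = 0 := by
      intro j
      induction j with
      | zero => simpa using hz
      | succ j ih => rw [Nat.cast_succ, ← sub_sub]; exact h _ ih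
    have h1 := hall m.toNat
    have h2 := hanti (z - m)
    rw [Int.toNat_of_nonneg (by omega)] at h1
    rw [sub_add_cancel] at h2
    omega
  have hex : ∃ j : ℕ, R (v + j) ≠ 0 := by
    refine ⟨m.toNat, ?_⟩
    have := hanti v
    rw [Int.toNat_of_nonneg (by omega)]
    omega
  classical
  obtain ⟨t, ht, htmin⟩ : ∃ t : ℕ, R (v + t) ≠ 0 ∧ ∀ j < t, R (v + j) = 0 :=
    ⟨Nat.find hex, Nat.find_spec hex, fun j hj => not_not.1 (Nat.find_min hex hj)⟩
  have hrun : ∀ x : ℤ, v ≤ x → x < v + t → R x = 0 := fun x h1 h2 => by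
    have h := htmin (x - v).toNat (by omega)
    rwa [Int.toNat_of_nonneg (by omega), add_sub_cancel] at h
  have ht0 : 0 < t := by
    rcases Nat.eq_zero_or_pos t with h | h
    · simp [h, hv] at ht
    · exact h
  have htm : (t : ℤ) ≤ m := by
    by_contra! h
    have h1 := hrun (v + m) (by omega) (by omega)
    have h2 := hanti v
    omega
  have hzero : ∀ x, R x = 0 → v - m ≤ x → x ≤ v + m → v ≤ x ∧ x < v + t := by
    intro x hx h1 h2
    have h3 := hanti v
    have h4 := hanti (v - m)
    rw [sub_add_cancel] at h4
    have h5 : x ≠ v + m := by rintro rfl; omega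
    have h6 : x ≠ v - m := by rintro rfl; omega
    have h7 : x ≠ v + t := by rintro rfl; exact ht hx
    have h8 : x ≠ v - 1 := by rintro rfl; exact hv' hx
    by_contra hcon
    rcases lt_or_ge x v with h | h
    · exact hv' (rotation_zero_convex hanti hstep hx hv (by omega) (by omega) (by omega))
    · exact ht (rotation_zero_convex hanti hstep hv hx (by omega) (by omega) (by omega))
  have hzero' : ∀ x, v + t ≤ x → x < v + 2 * m → R x ≠ 0 := by
    intro x h1 h2 h3
    by_cases h : x ≤ v + m
    · have := hzero x h3 (by omega) h; omega
    · have h4 := hper (x - 2 * m)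
      rw [sub_add_cancel] at h4
      have := hzero (x - 2 * m) (by omega) (by omega) (by omega)
      omega
  have hend : ∀ k, v + m ≤ k → k < v + m + t → R k = m - 1 := fun k h1 h2 => by
    have h3 := hanti (k - m)
    rw [sub_add_cancel, hrun (k - m) (by omega) (by omega)] at h3
    omega
  have hleg : ∀ k, v + t ≤ k → k < v + m → v < k - R k ∧ k - R k < v + t := by
    intro k h1 h2
    have hk0 := hzero' k h1 (by omega)
    have hkm : R k ≠ m - 1 := fun h => by
      have h3 := hanti k
      exact hzero' (k + m) (by omega) (by omega) (by omega)
    have h3 := hR0 k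
    have h4 := hRm k
    have h5 := hsucc' k
    have h6 := hpred' k
    have h7 := (hsucc k).resolve_left (hzero' _ (by omega) (by omega))
    have h8 := (hpred k).resolve_left (hzero' _ (by omega) (by omega))
    have h9 := hzero (k - R k) (by omega) (by omega) (by omega)
    have h10 := hzero (k - R k - 1) (by omega) (by omega) (by omega)
    omega
  have hmono : ∀ k l, v + t ≤ k → k ≤ l → l < v + m → l - R l ≤ k - R k := by
    intro k l h1 h2
    induction l, h2 using Int.leInduction with
    | base => intro _; exact le_rfl
    | succ l hl ih =>
      intro h3
      have h4 := ih (by omega)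
      have h5 := hleg l (by omega) (by omega)
      have h6 := (hsucc l).resolve_left (hzero' _ (by omega) (by omega))
      omega
  have ht2 : 2 ≤ t := by
    by_contra! h
    have := hleg (v + t) le_rfl (by omega)
    omega
  have hleft : ∀ x, v < x → x < v + t → R (x + s x) < s x → x + s x < v + m := by
    intro x h1 h2 h3
    by_contra! h
    have := hend (x + s x) h (by have := hsm x; omega)
    have := hsm x
    omega
  have hright : ∀ x, v < x → s x < R (x + s x) → v + t ≤ x + s x := by
    intro x h1 h3
    by_contra! h
    have := hrun (x + s x) (by have := hs0 x; omega) h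
    have := hs0 x
    omega
  have hall : ∀ j : ℕ, v + 1 + j < v + t → R (v + 1 + j + s (v + 1 + j)) < s (v + 1 + j) := by
    intro j
    induction j with
    | zero =>
      intro h
      simp only [Nat.cast_zero, add_zero] at h ⊢
      refine lt_of_le_of_ne (not_lt.1 fun h1 => ?_) (hne _)
      have h2 := hright _ (by omega) h1
      have h3 := hs0 (v + 1)
      have h4 := hsm (v + 1)
      by_cases h5 : v + 1 + s (v + 1) < v + m
      · have := hleg _ h2 h5
        omega
      · have := hend (v + 1 + s (v + 1)) (by omega) (by omega)
        omega
    | succ j ih =>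
      intro h
      push_cast at h ⊢
      have h1 := ih (by omega)
      rw [← add_assoc] at h ⊢
      have hav : v < v + 1 + (j : ℤ) := by omega
      generalize v + 1 + (j : ℤ) = a at h h1 hav ⊢
      refine lt_of_le_of_ne (not_lt.1 fun h2 => ?_) (hne _)
      have h3 := hleft a hav (by omega) h1
      have h4 := hright (a + 1) (by omega) h2
      have h5 := hs0 a
      have h6 : s a ≠ 0 := fun h0 => by
        have := hne a
        rw [h0, add_zero, hrun a (by omega) (by omega)] at this
        exact this rfl
      have h7 : s (a + 1) ≠ m - 1 := fun h0 => by
        have := hne (a + 1)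
        rw [h0, hend _ (by omega) (by omega)] at this
        exact this rfl
      refine h7 (hcross a (by omega) ?_)
      by_contra! h8
      have := hmono _ _ h4 (by omega) h3
      omega
  have h1 := hall (t - 2) (by omega)
  rw [show v + 1 + ((t - 2 : ℕ) : ℤ) = v + t - 1 by omega] at h1
  have h2 := hR0 (v + t - 1 + s (v + t - 1))
  have h3 := hleft _ (by omega) (by omega) h1
  have := hleg (v + t - 1 + s (v + t - 1)) (by omega) h3
  omega

/-- The edge joining the residues of the integers `x` and `y`. -/
def chord (m : ℕ) (x y : ℤ) : Sym2 (Vtx m) := s((x : Vtx m), (y : Vtx m))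

lemma chord_comm (m : ℕ) (x y : ℤ) : chord m x y = chord m y x := Sym2.eq_swap

lemma cast_add_period (m : ℕ) (x : ℤ) : ((x + 2 * m : ℤ) : Vtx m) = x := by
  have h := ZMod.natCast_self (2 * m)
  push_cast at h ⊢
  rw [h, add_zero]

lemma chord_add_period (m : ℕ) (x y : ℤ) : chord m x (y + 2 * m) = chord m y x := by
  rw [chord, cast_add_period, ← chord, chord_comm]

lemma eq_of_cast_eq {m : ℕ} {x y : ℤ} (h : (x : Vtx m) = y) (h1 : x < y + 2 * m)
    (h2 : y < x + 2 * m) : x = y := by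
  rw [ZMod.intCast_eq_intCast_iff_dvd_sub] at h
  obtain ⟨c, hc⟩ := h
  push_cast at hc
  have h3 : c < 1 := by nlinarith
  have h4 : -1 < c := by nlinarith
  obtain rfl : c = 0 := by omega
  omega

lemma exists_cast_eq {m : ℕ} (hm : 1 ≤ m) (v : ℤ) (y : Vtx m) :
    ∃ w : ℤ, v ≤ w ∧ w < v + 2 * m ∧ (w : Vtx m) = y := by
  have : NeZero (2 * m) := ⟨by omega⟩
  have h := ZMod.val_lt (y - (v : Vtx m))
  refine ⟨v + ((y - (v : Vtx m)).val : ℕ), by omega, by omega, ?_⟩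
  push_cast
  rw [ZMod.natCast_zmod_val]
  ring

lemma exists_eq_chord {m : ℕ} (hm : 1 ≤ m) {v : ℤ} {e : Sym2 (Vtx m)} (he : ¬ e.IsDiag)
    (hv : (v : Vtx m) ∈ e) : ∃ w, v < w ∧ w < v + 2 * m ∧ e = chord m v w := by
  obtain ⟨y, rfl⟩ := Sym2.mem_iff_exists.1 hv
  obtain ⟨w, h1, h2, rfl⟩ := exists_cast_eq hm v y
  refine ⟨w, lt_of_le_of_ne h1 ?_, h2, rfl⟩
  rintro rfl
  exact he (Sym2.mk_isDiag_iff.2 rfl)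

lemma not_isDiag_chord {m : ℕ} {x y : ℤ} (h1 : x < y) (h2 : y < x + 2 * m) :
    ¬ (chord m x y).IsDiag := fun h => by
  have := eq_of_cast_eq (Sym2.mk_isDiag_iff.1 h) (by omega) h2
  omega

lemma val_cast_sub {m : ℕ} {x y : ℤ} (h1 : x ≤ y) (h2 : y < x + 2 * m) :
    (((y : Vtx m) - (x : Vtx m)).val : ℤ) = y - x := by
  have : NeZero (2 * m) := ⟨by omega⟩
  rw [← Int.cast_sub, ZMod.val_intCast]
  exact Int.emod_eq_of_lt (by omega) (by push_cast; omega)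

lemma odd_edgeOrder_chord {m : ℕ} {x y : ℤ} (h1 : x < y) (h2 : y < x + 2 * m) :
    Odd (edgeOrder m (chord m x y)) ↔ Odd (y - x) := by
  have h3 := val_cast_sub (m := m) h1.le h2
  have h4 := val_cast_sub (m := m) (x := y) (y := x + 2 * m) (by omega) (by omega)
  rw [cast_add_period] at h4
  have h5 : edgeOrder m (chord m x y) =
    min ((x : Vtx m) - (y : Vtx m)).val ((y : Vtx m) - (x : Vtx m)).val := rfl
  rw [h5, ← Int.odd_coe_nat, Nat.cast_min, h3, h4]
  rcases min_choice (x + 2 * (m : ℤ) - y) (y - x) with h | h <;> rw [h]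
  rw [Int.odd_iff, Int.odd_iff]
  omega

lemma edgeDir_chord (m : ℕ) (x y : ℤ) : edgeDir m (chord m x y) = ((x + y : ℤ) : Vtx m) := by
  rw [Int.cast_add]; rfl

lemma inArc_cast_iff {m : ℕ} {a b c : ℤ} (h1 : a ≤ b) (h2 : b < a + 2 * m) (h3 : a ≤ c)
    (h4 : c < a + 2 * m) : InArc m a b c ↔ a < c ∧ c < b := by
  have h5 := val_cast_sub (m := m) h1 h2
  have h6 := val_cast_sub (m := m) h3 h4
  unfold InArc
  omega

lemma crosses_chord {m : ℕ} {a b c d : ℤ} (h1 : a < c) (h2 : c < b) (h3 : b < d)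
    (h4 : d < a + 2 * m) : Crosses m (chord m a b) (chord m c d) := by
  refine ⟨a, b, c, d, rfl, rfl, Or.inl ⟨?_, ?_⟩⟩ <;>
    rw [inArc_cast_iff] <;> omega

lemma not_crosses_chord_of_inside {m : ℕ} {a b c d : ℤ} (h1 : b < a + 2 * m)
    (hac : a < c) (hcb : c < b) (had : a < d) (hdb : d < b) :
    ¬ Crosses m (chord m a b) (chord m c d) := by
  rintro ⟨a', b', c', d', he, hf, hx⟩
  have key : ∀ a' b' : Vtx m, chord m a b = s(a', b') →
      (InArc m a' b' c ↔ InArc m a' b' d) := by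
    intro a' b' he
    rcases Sym2.eq_iff.1 he with ⟨rfl, rfl⟩ | ⟨rfl, rfl⟩
    · rw [inArc_cast_iff, inArc_cast_iff] <;> omega
    · rw [← cast_add_period m a, ← cast_add_period m c, ← cast_add_period m d,
        inArc_cast_iff, inArc_cast_iff] <;> omega
  have hcd := key a' b' he
  rcases Sym2.eq_iff.1 hf with ⟨rfl, rfl⟩ | ⟨rfl, rfl⟩ <;> rcases hx with hx | hx <;> tauto

lemma not_crosses_chord_of_outside {m : ℕ} {a b c d : ℤ} (hab : a < b)
    (hbc : b < c) (hca : c < a + 2 * m) (hbd : b < d) (hda : d < a + 2 * m) :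
    ¬ Crosses m (chord m a b) (chord m c d) := by
  rw [← chord_add_period m b a]
  exact not_crosses_chord_of_inside (by omega) hbc hca hbd hda

lemma IsPM.exists_partner {m : ℕ} (hm : 1 ≤ m) {M : Finset (Sym2 (Vtx m))} (hM : IsPM m M)
    (x : ℤ) : ∃ y, x < y ∧ y < x + 2 * m ∧ chord m x y ∈ M := by
  obtain ⟨e, he, hx⟩ := hM.2.2 x
  obtain ⟨w, h1, h2, rfl⟩ := exists_eq_chord hm (hM.1 e he) hx
  exact ⟨w, h1, h2, he⟩

lemma IsPM.eq_of_mem {m : ℕ} {M : Finset (Sym2 (Vtx m))} (hM : IsPM m M)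
    {e f : Sym2 (Vtx m)} (he : e ∈ M) (hf : f ∈ M) {x : Vtx m} (hxe : x ∈ e) (hxf : x ∈ f) :
    e = f := by
  by_contra h
  exact hM.2.1 e he f hf h x hxe hxf

lemma left_mem_chord (m : ℕ) (x y : ℤ) : (x : Vtx m) ∈ chord m x y := Sym2.mem_mk_left _ _

lemma right_mem_chord (m : ℕ) (x y : ℤ) : (y : Vtx m) ∈ chord m x y := Sym2.mem_mk_right _ _

lemma IsPM.cast_eq {m : ℕ} {M : Finset (Sym2 (Vtx m))} (hM : IsPM m M) {x y z : ℤ}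
    (hy : chord m x y ∈ M) (hz : chord m x z ∈ M) : (y : Vtx m) = z :=
  Sym2.congr_right.1 (hM.eq_of_mem hy hz (left_mem_chord m x y) (left_mem_chord m x z))

lemma chord_ne_of_cast_ne {m : ℕ} {a b c d : ℤ} (h1 : (c : Vtx m) ≠ a) (h2 : (c : Vtx m) ≠ b) :
    chord m a b ≠ chord m c d := fun h => by
  have := left_mem_chord m c d
  rw [← h] at this
  rcases Sym2.mem_iff.1 this with h | h
  · exact h1 h
  · exact h2 h

lemma chord_ne {m : ℕ} {a b c d : ℤ} (h1 : a < c) (h2 : c < b) (h3 : b < a + 2 * m) :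
    chord m a b ≠ chord m c d := by
  apply chord_ne_of_cast_ne
  · intro h
    have := eq_of_cast_eq h (by omega) (by omega)
    omega
  · intro h
    have := eq_of_cast_eq h (by omega) (by omega)
    omega

lemma IsSPM.not_interleaved {m : ℕ} {M : Finset (Sym2 (Vtx m))} (hM : IsSPM m M)
    {a b c d : ℤ} (hab : chord m a b ∈ M) (hcd : chord m c d ∈ M) (h1 : a < c) (h2 : c < b)
    (h3 : b < d) : a + 2 * m ≤ d := by
  by_contra! h4
  exact hM.2 _ hab _ hcd (chord_ne h1 h2 (by omega)) (crosses_chord h1 h2 h3 h4)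

lemma IsSPM.exists_partner_inside {m : ℕ} (hm : 1 ≤ m) {M : Finset (Sym2 (Vtx m))}
    (hM : IsSPM m M) {a b x : ℤ} (hab : chord m a b ∈ M) (hb : b < a + 2 * m) (hax : a < x)
    (hxb : x < b) : ∃ y, a < y ∧ y < b ∧ chord m x y ∈ M := by
  obtain ⟨y, h1, h2, h3⟩ := hM.1.exists_partner hm x
  rcases lt_trichotomy y b with h | rfl | h
  · exact ⟨y, by omega, h, h3⟩
  · rw [chord_comm] at hab h3
    have := eq_of_cast_eq (hM.1.cast_eq hab h3) (by omega) (by omega)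
    omega
  · have h4 := hM.not_interleaved hab h3 hax hxb h
    refine ⟨y - 2 * m, ?_, by omega, ?_⟩
    · refine lt_of_le_of_ne (by omega) ?_
      rintro rfl
      rw [← chord_add_period, sub_add_cancel, chord_comm] at hab
      rw [chord_comm] at h3
      have := eq_of_cast_eq (hM.1.cast_eq hab h3) (by omega) (by omega)
      omega
    · rwa [chord_comm, ← chord_add_period, sub_add_cancel]

lemma IsSPM.odd_sub {m : ℕ} (hm : 1 ≤ m) {M : Finset (Sym2 (Vtx m))}
    (hM : IsSPM m M) {a b : ℤ} (hab : chord m a b ∈ M) (h1 : a < b) (h2 : b < a + 2 * m) :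
    Odd (b - a) := by
  choose! g hg using fun x (hx : x ∈ Finset.Ioo a b) =>
    hM.exists_partner_inside hm hab h2 (Finset.mem_Ioo.1 hx).1 (Finset.mem_Ioo.1 hx).2
  have hsum : ∑ _x ∈ Finset.Ioo a b, (1 : ZMod 2) = 0 := by
    refine Finset.sum_involution (fun x _ => g x) (fun _ _ => by decide) ?_
      (fun x hx => Finset.mem_Ioo.2 ⟨(hg x hx).1, (hg x hx).2.1⟩) ?_
    · intro x hx _ h
      have h3 := hM.1.1 _ (hg x hx).2.2
      rw [h] at h3
      exact h3 (Sym2.mk_isDiag_iff.2 rfl)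
    · intro x hx
      have hgx : g x ∈ Finset.Ioo a b := Finset.mem_Ioo.2 ⟨(hg x hx).1, (hg x hx).2.1⟩
      have h3 := (hg x hx).2.2
      have h4 := hg _ hgx
      rw [chord_comm] at h3
      rw [Finset.mem_Ioo] at hx
      exact eq_of_cast_eq (hM.1.cast_eq h4.2.2 h3) (by omega) (by omega)
  rw [Finset.sum_const, nsmul_one, Int.card_Ioo, ZMod.natCast_eq_zero_iff] at hsum
  rw [Int.odd_iff]
  omega

/-- A fixed-point-free involution of `2m` consecutive integers whose orbits are pairwise
nested or disjoint defines a simple perfect matching. -/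
lemma isSPM_image {m : ℕ} (hm : 1 ≤ m) {v : ℤ} {g : ℤ → ℤ}
    (hg : ∀ x, v ≤ x → x < v + 2 * m → v ≤ g x ∧ g x < v + 2 * m ∧ g (g x) = x ∧ g x ≠ x)
    (hnest : ∀ x y, v ≤ x → x < y → y < g x → x < g y ∧ g y < g x) :
    IsSPM m ((Finset.Ico v (v + 2 * m)).image fun x => chord m x (g x)) := by
  have hmem : ∀ e, e ∈ ((Finset.Ico v (v + 2 * m)).image fun x => chord m x (g x)) →
      ∃ x, v ≤ x ∧ x < g x ∧ g x < v + 2 * m ∧ e = chord m x (g x) := by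
    intro e he
    obtain ⟨x, hx, rfl⟩ := Finset.mem_image.1 he
    rw [Finset.mem_Ico] at hx
    obtain ⟨h1, h2, h3, h4⟩ := hg x hx.1 hx.2
    rcases lt_or_gt_of_ne h4 with h | h
    · exact ⟨g x, h1, by omega, by omega, by rw [h3, chord_comm]⟩
    · exact ⟨x, hx.1, h, h2, rfl⟩
  have hsep : ∀ x y, v ≤ x → x < g x → g x < v + 2 * m → v ≤ y → y < g y →
      g y < v + 2 * m → x < y → ¬ Crosses m (chord m x (g x)) (chord m y (g y)) ∧
      ¬ Crosses m (chord m y (g y)) (chord m x (g x)) ∧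
      ∀ z : Vtx m, z ∈ chord m x (g x) → z ∉ chord m y (g y) := by
    intro x y hx hx' hx'' hy hy' hy'' hxy
    obtain ⟨-, -, hgx, -⟩ := hg x hx (by omega)
    have hne : y ≠ g x := by rintro rfl; omega
    have hcase : (y < g x ∧ g y < g x) ∨ g x < y := by
      by_cases h : y < g x
      · exact Or.inl ⟨h, (hnest x y hx hxy h).2⟩
      · exact Or.inr (by omega)
    refine ⟨?_, ?_, fun z hz hz' => ?_⟩
    · rcases hcase with h | h
      · exact not_crosses_chord_of_inside (by omega) hxy h.1 (by omega) h.2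
      · exact not_crosses_chord_of_outside (by omega) h (by omega) (by omega) (by omega)
    · rcases hcase with h | h
      · rw [← chord_add_period m (g x) x]
        exact not_crosses_chord_of_outside (by omega) h.2 (by omega) (by omega) (by omega)
      · rw [← chord_add_period m (g x) x, ← chord_add_period m (x + 2 * m) (g x)]
        exact not_crosses_chord_of_outside (by omega) (by omega) (by omega) (by omega) (by omega)
    · rcases Sym2.mem_iff.1 hz with rfl | rfl <;> rcases Sym2.mem_iff.1 hz' with h | h <;>
        have := eq_of_cast_eq h (by omega) (by omega) <;> omega
  refine ⟨⟨?_, ?_, ?_⟩, ?_⟩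
  · intro e he
    obtain ⟨x, h1, h2, h3, rfl⟩ := hmem e he
    exact not_isDiag_chord h2 (by omega)
  · intro e he f hf hne z hze hzf
    obtain ⟨x, h1, h2, h3, rfl⟩ := hmem e he
    obtain ⟨y, h4, h5, h6, rfl⟩ := hmem f hf
    rcases lt_trichotomy x y with h | rfl | h
    · exact (hsep x y h1 h2 h3 h4 h5 h6 h).2.2 z hze hzf
    · exact hne rfl
    · exact (hsep y x h4 h5 h6 h1 h2 h3 h).2.2 z hzf hze
  · intro z
    obtain ⟨x, h1, h2, rfl⟩ := exists_cast_eq hm v z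
    exact ⟨_, Finset.mem_image_of_mem _ (Finset.mem_Ico.2 ⟨h1, h2⟩), left_mem_chord _ _ _⟩
  · intro e he f hf hne
    obtain ⟨x, h1, h2, h3, rfl⟩ := hmem e he
    obtain ⟨y, h4, h5, h6, rfl⟩ := hmem f hf
    rcases lt_trichotomy x y with h | rfl | h
    · exact (hsep x y h1 h2 h3 h4 h5 h6 h).1
    · exact absurd rfl hne
    · exact (hsep y x h4 h5 h6 h1 h2 h3 h).2.1

/-- The partner of `x` in the simple perfect matching formed by three consecutive stacks of
nested edges on the vertices `v, …, v + 2m - 1`, the stacks having `L`, `1` and `m - 1 - L`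
edges. -/
def stackPartner (m : ℕ) (v L x : ℤ) : ℤ :=
  if x < v + 2 * L then 2 * v + 2 * L - 1 - x
  else if x < v + 2 * L + 2 then 2 * v + 4 * L + 1 - x
  else 2 * v + 2 * m + 2 * L + 1 - x

/-- The simple perfect matching formed by three consecutive stacks of nested edges. -/
noncomputable def stackSPM (m : ℕ) (v L : ℤ) : Finset (Sym2 (Vtx m)) :=
  (Finset.Ico v (v + 2 * m)).image fun x => chord m x (stackPartner m v L x)

lemma isSPM_stackSPM {m : ℕ} (hm : 1 ≤ m) (v : ℤ) {L : ℤ} (h0 : 0 ≤ L) (hL : L < m) :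
    IsSPM m (stackSPM m v L) := by
  refine isSPM_image hm (fun x h1 h2 => ?_) (fun x y h1 h2 h3 => ?_) <;>
    unfold stackPartner at * <;> split_ifs at * <;> omega

lemma edgeDir_of_mem_stackSPM {m : ℕ} {k : ℤ} {e : Sym2 (Vtx m)} (he : e ∈ stackSPM m k 0) :
    edgeDir m e = ((2 * k + 1 : ℤ) : Vtx m) := by
  obtain ⟨x, hx, rfl⟩ := Finset.mem_image.1 he
  rw [Finset.mem_Ico] at hx
  rw [edgeDir_chord]
  unfold stackPartner
  split_ifs
  · omega
  · congr 1; ring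
  · rw [← cast_add_period m (2 * k + 1)]; congr 1; ring

lemma exists_of_mem_stackSPM {m : ℕ} {k : ℤ} {e : Sym2 (Vtx m)} (he : e ∈ stackSPM m k 0) :
    ∃ r : ℤ, 0 ≤ r ∧ r < m ∧ e = chord m (k - r) (k + 1 + r) := by
  obtain ⟨x, hx, rfl⟩ := Finset.mem_image.1 he
  rw [Finset.mem_Ico] at hx
  have hx' := hx.2
  unfold stackPartner
  split_ifs
  · omega
  · rcases (by omega : x = k ∨ x = k + 1) with rfl | rfl
    · exact ⟨0, le_rfl, by omega, by congr 1 <;> ring⟩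
    · exact ⟨0, le_rfl, by omega, by rw [chord_comm]; congr 1 <;> ring⟩
  · by_cases h : x ≤ k + m
    · refine ⟨x - k - 1, by omega, by omega, ?_⟩
      rw [show 2 * k + 2 * (m : ℤ) + 2 * 0 + 1 - x = 2 * k + 1 - x + 2 * m by ring,
        chord_add_period]
      congr 1 <;> ring
    · refine ⟨2 * m + k - x, by omega, by omega, ?_⟩
      rw [show chord m x (2 * k + 2 * m + 2 * 0 + 1 - x) =
        chord m (2 * k + 2 * m + 2 * 0 + 1 - x) (x - 2 * m + 2 * m) by
          rw [chord_comm, sub_add_cancel], chord_add_period]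
      congr 1 <;> ring

/-- A set of edges meeting every simple perfect matching contains an edge of each of the `m` odd
directions. -/
lemma le_card_of_meets_SPM {m : ℕ} (hm : 1 ≤ m) {B : Finset (Sym2 (Vtx m))}
    (hB : ∀ M, IsSPM m M → (B ∩ M).Nonempty) : m ≤ B.card ∧ (B.card ≤ m →
      ∀ e ∈ B, ∀ f ∈ B, edgeDir m e = edgeDir m f → e = f) := by
  choose e he using fun k : ℕ => hB _ (isSPM_stackSPM hm k le_rfl (by omega))
  simp only [Finset.mem_inter] at he
  have hinj : Set.InjOn e (Finset.range m) := by
    intro k hk l hl hkl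
    have hk' := edgeDir_of_mem_stackSPM (he k).2
    have hl' := edgeDir_of_mem_stackSPM (he l).2
    rw [Finset.coe_range, Set.mem_Iio] at hk hl
    rw [hkl, hl'] at hk'
    have := eq_of_cast_eq hk' (by omega) (by omega)
    omega
  have hsub : (Finset.range m).image e ⊆ B := Finset.image_subset_iff.2 fun k _ => (he k).1
  have hcard : ((Finset.range m).image e).card = m := by
    rw [Finset.card_image_of_injOn hinj, Finset.card_range]
  refine ⟨hcard.symm.trans_le (Finset.card_le_card hsub), fun hle f hf f' hf' hff' => ?_⟩
  have himg := Finset.eq_of_subset_of_card_le hsub (by omega)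
  rw [← himg, Finset.mem_image] at hf hf'
  obtain ⟨k, hk, rfl⟩ := hf
  obtain ⟨l, hl, rfl⟩ := hf'
  rw [edgeDir_of_mem_stackSPM (he k).2, edgeDir_of_mem_stackSPM (he l).2] at hff'
  rw [Finset.mem_range] at hk hl
  have := eq_of_cast_eq hff' (by omega) (by omega)
  congr 1
  omega

/-- The double star with centers `v` and `v + 1` in which `v + 1` is joined to
`v + 2, v + 4, …, v + 2s`, and `v` is joined to `v + 1` and to
`v + 2s + 3, v + 2s + 5, …, v + 2m - 1`. -/
def doubleStar (m : ℕ) (v : ℤ) (s : ℕ) : Finset (Sym2 (Vtx m)) :=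
  (Finset.range m).image fun j : ℕ =>
    if j < s then chord m (v + 1) (v + 2 * j + 2)
    else if j = s then chord m v (v + 1)
    else chord m v (v + 2 * j + 1)

lemma exists_chord_of_mem_doubleStar {m : ℕ} {v : ℤ} {s : ℕ} {e : Sym2 (Vtx m)}
    (he : e ∈ doubleStar m v s) :
    e = chord m v (v + 1) ∨
    (∃ j : ℤ, 0 ≤ j ∧ j < s ∧ j < m ∧ e = chord m (v + 1) (v + 2 * j + 2)) ∨
    ∃ j : ℤ, s < j ∧ j < m ∧ e = chord m v (v + 2 * j + 1) := by
  obtain ⟨j, hj, rfl⟩ := Finset.mem_image.1 he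
  rw [Finset.mem_range] at hj
  split_ifs with h1 h2
  · exact Or.inr (Or.inl ⟨j, by omega, by omega, by omega, rfl⟩)
  · exact Or.inl rfl
  · exact Or.inr (Or.inr ⟨j, by omega, by omega, rfl⟩)

lemma doubleStar_meets_SPM {m : ℕ} (hm : 1 ≤ m) (v : ℤ) {s : ℕ} (hs : s < m)
    {M : Finset (Sym2 (Vtx m))} (hM : IsSPM m M) : (doubleStar m v s ∩ M).Nonempty := by
  obtain ⟨q, h1, h2, hq⟩ := hM.1.exists_partner hm v
  obtain ⟨c, hc⟩ := hM.odd_sub hm hq h1 h2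
  obtain rfl : q = v + 2 * c + 1 := by omega
  suffices ∃ j ∈ Finset.range m, (if j < s then chord m (v + 1) (v + 2 * j + 2)
    else if j = s then chord m v (v + 1) else chord m v (v + 2 * j + 1)) ∈ M by
    obtain ⟨j, hj, hjM⟩ := this
    exact ⟨_, Finset.mem_inter.2 ⟨Finset.mem_image_of_mem _ hj, hjM⟩⟩
  rcases (by omega : c = 0 ∨ (s : ℤ) < c ∨ 0 < c ∧ c ≤ s) with rfl | h | h
  · refine ⟨s, Finset.mem_range.2 hs, ?_⟩
    simpa using hq
  · refine ⟨c.toNat, Finset.mem_range.2 (by omega), ?_⟩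
    rwa [if_neg (by omega), if_neg (by omega), Int.toNat_of_nonneg (by omega)]
  · obtain ⟨y, h3, h4, hy⟩ := hM.exists_partner_inside hm hq h2 (x := v + 1) (by omega) (by omega)
    have h5 : y ≠ v + 1 := by
      rintro rfl
      exact hM.1.1 _ hy (Sym2.mk_isDiag_iff.2 rfl)
    obtain ⟨d, hd⟩ := hM.odd_sub hm hy (by omega) (by omega)
    refine ⟨d.toNat, Finset.mem_range.2 (by omega), ?_⟩
    rw [if_pos (by omega), Int.toNat_of_nonneg (by omega)]
    rwa [show v + 2 * d + 2 = y by omega]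

lemma isBlocker_doubleStar {m : ℕ} (hm : 1 ≤ m) (v : ℤ) {s : ℕ} (hs : s < m) :
    IsBlocker m (doubleStar m v s) := by
  refine ⟨fun e he => ?_, fun M hM => doubleStar_meets_SPM hm v hs hM, fun B' _ hB' => ?_⟩
  · rcases exists_chord_of_mem_doubleStar he with rfl | ⟨j, h1, h2, h3, rfl⟩ | ⟨j, h1, h2, rfl⟩ <;>
      exact not_isDiag_chord (by omega) (by omega)
  · refine le_trans ?_ (le_card_of_meets_SPM hm hB').1
    exact Finset.card_image_le.trans_eq (Finset.card_range m)

lemma IsBlocker.card_eq {m : ℕ} (hm : 1 ≤ m) {B : Finset (Sym2 (Vtx m))} (hB : IsBlocker m B) :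
    B.card = m := by
  refine le_antisymm ?_ (le_card_of_meets_SPM hm hB.2.1).1
  have h := isBlocker_doubleStar hm 0 (s := 0) (by omega)
  exact (hB.2.2 _ h.1 h.2.1).trans (Finset.card_image_le.trans_eq (Finset.card_range m))

/-- The edges of a blocker, one in each odd direction. -/
lemma IsBlocker.exists_rotation {m : ℕ} (hm : 1 ≤ m) {B : Finset (Sym2 (Vtx m))}
    (hB : IsBlocker m B) : ∃ R : ℤ → ℤ, (∀ k, 0 ≤ R k ∧ R k < m) ∧
      ∀ k r : ℤ, 0 ≤ r → r < m → (chord m (k - r) (k + 1 + r) ∈ B ↔ r = R k) := by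
  have hex : ∀ k : ℤ, ∃ r : ℤ, 0 ≤ r ∧ r < m ∧ chord m (k - r) (k + 1 + r) ∈ B := by
    intro k
    obtain ⟨e, he⟩ := hB.2.1 _ (isSPM_stackSPM hm k le_rfl (by omega))
    rw [Finset.mem_inter] at he
    obtain ⟨r, h1, h2, rfl⟩ := exists_of_mem_stackSPM he.2
    exact ⟨r, h1, h2, he.1⟩
  choose R hR0 hRm hRB using hex
  refine ⟨R, fun k => ⟨hR0 k, hRm k⟩, fun k r h1 h2 => ⟨fun h => ?_, fun h => h ▸ hRB k⟩⟩
  have h3 := (le_card_of_meets_SPM hm hB.2.1).2 (hB.card_eq hm).le _ h _ (hRB k)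
    (by rw [edgeDir_chord, edgeDir_chord]; congr 1; ring)
  have h4 := hR0 k
  have h5 := hRm k
  rcases Sym2.eq_iff.1 h3 with h | h
  · have := eq_of_cast_eq h.1 (by omega) (by omega)
    omega
  · have := eq_of_cast_eq h.1 (by omega) (by omega)
    omega

lemma IsBlocker.inter_nonempty {m : ℕ} (hm : 1 ≤ m) {B M : Finset (Sym2 (Vtx m))}
    (hB : IsBlocker m B) (hM : IsSemiSimple m M) : (B ∩ M).Nonempty := by
  obtain ⟨hPM, hodd, hcross⟩ := hM
  rcases (by omega : m = 1 ∨ 2 ≤ m) with rfl | hm2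
  · refine hB.2.1 M ⟨hPM, fun e he f hf hne => hcross e he f hf hne ?_⟩
    have hx := Sym2.out_fst_mem e
    have hy := Sym2.out_fst_mem f
    refine ⟨_, hx, _, hy, ?_⟩
    have hne' : (Quot.out e).1 ≠ (Quot.out f).1 := fun h =>
      hne (hPM.eq_of_mem he hf hx (h ▸ hy))
    exact (by decide : ∀ x y : Vtx 1, x ≠ y → x = y + 1 ∨ y = x + 1) _ _ hne'
  obtain ⟨R, hR, hRB⟩ := hB.exists_rotation hm
  have hpartner : ∀ x : ℤ, ∃ s : ℤ, 0 ≤ s ∧ s < m ∧ chord m x (x + 1 + 2 * s) ∈ M := by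
    intro x
    obtain ⟨q, h1, h2, hq⟩ := hPM.exists_partner hm x
    obtain ⟨c, hc⟩ := (odd_edgeOrder_chord h1 h2).1 (hodd _ hq)
    refine ⟨c, by omega, by omega, ?_⟩
    rwa [show x + 1 + 2 * c = q by omega]
  choose s hs0 hsm hsM using hpartner
  have hanti : ∀ k, R (k + m) = m - 1 - R k := fun k => by
    have h := hR k
    refine ((hRB (k + m) (m - 1 - R k) (by omega) (by omega)).1 ?_).symm
    rw [show k + m + 1 + (m - 1 - R k) = k - R k + 2 * m by ring, chord_add_period,
      show k + m - (m - 1 - R k) = k + 1 + R k by ring]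
    exact (hRB k (R k) h.1 h.2).2 rfl
  have hval : ∀ k x y : ℤ, y = 2 * k + 1 - x → k - m < x → x ≤ k + m → chord m x y ∈ B →
      R k = k - x ∨ R k = x - k - 1 := by
    rintro k x y rfl h1 h2 h
    rcases le_or_gt x k with h3 | h3
    · refine Or.inl ((hRB k (k - x) (by omega) (by omega)).1 ?_).symm
      convert h using 2 <;> ring
    · refine Or.inr ((hRB k (x - k - 1) (by omega) (by omega)).1 ?_).symm
      rw [chord_comm]
      convert h using 2 <;> ring
  obtain ⟨x, hx⟩ := exists_rotation_eq (m := m) (R := R) (s := s) (by omega)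
    (fun k => (hR k).1) hanti
    (fun i L h0 hL => by
      obtain ⟨e, he⟩ := hB.2.1 _ (isSPM_stackSPM hm (i - 2 * L) h0 hL)
      rw [Finset.mem_inter] at he
      obtain ⟨heB, heS⟩ := he
      obtain ⟨x, hx, rfl⟩ := Finset.mem_image.1 heS
      rw [Finset.mem_Ico] at hx
      unfold stackPartner at heB
      split_ifs at heB
      · have := hval (i - L - 1) _ _ (by ring) (by omega) (by omega) heB
        omega
      · have := hval i _ _ (by ring) (by omega) (by omega) heB
        have := hR i
        omega
      · have := hval (i - L + m) _ _ (by ring) (by omega) (by omega) heB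
        have := hanti (i - L)
        omega)
    hs0 hsm
    (fun x h1 h2 => by
      by_contra h3
      have h4 := hsm (x + 1)
      refine hcross _ (hsM x) _ (hsM (x + 1)) (chord_ne (by omega) (by omega) ?_)
        ⟨_, left_mem_chord _ _ _, _, left_mem_chord _ _ _, Or.inr (by push_cast; rfl)⟩
        (crosses_chord ?_ ?_ ?_ ?_) <;> omega)
  refine ⟨_, Finset.mem_inter.2 ⟨?_, hsM x⟩⟩
  have h := (hRB (x + s x) (s x) (hs0 x) (hsm x)).2 hx.symm
  rwa [show x + s x - s x = x by ring, show x + s x + 1 + s x = x + 1 + 2 * s x by ring] at h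

lemma le_card_of_covers {m : ℕ} (hm : 1 ≤ m) {C : Finset (Sym2 (Vtx m))}
    (hC : ∀ x : Vtx m, ∃ e ∈ C, x ∈ e) : m ≤ C.card := by
  have : NeZero (2 * m) := ⟨by omega⟩
  have huniv : C.biUnion Sym2.toFinset = Finset.univ := by
    ext x
    obtain ⟨e, he, hx⟩ := hC x
    simpa using ⟨e, he, hx⟩
  have h1 : (C.biUnion Sym2.toFinset).card ≤ C.card * 2 :=
    Finset.card_biUnion_le_card_mul _ _ _ fun e _ => by
      rw [Sym2.card_toFinset]
      split_ifs <;> omega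
  rw [huniv, Finset.card_univ, ZMod.card] at h1
  omega

lemma isPM_of_covers {m : ℕ} (hm : 1 ≤ m) {C : Finset (Sym2 (Vtx m))}
    (hdiag : ∀ e ∈ C, ¬ e.IsDiag) (hC : ∀ x : Vtx m, ∃ e ∈ C, x ∈ e) (hcard : C.card ≤ m) :
    IsPM m C := by
  have : NeZero (2 * m) := ⟨by omega⟩
  refine ⟨hdiag, fun e he f hf hne x hxe hxf => ?_, hC⟩
  have huniv : (Finset.univ : Finset (Vtx m)) ⊆
      (C.erase e).biUnion Sym2.toFinset ∪ e.toFinset.erase x := by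
    intro y _
    obtain ⟨g, hg, hy⟩ := hC y
    by_cases hyx : y = x
    · subst hyx
      refine Finset.mem_union_left _ (Finset.mem_biUnion.2 ⟨f, ?_, Sym2.mem_toFinset.2 hxf⟩)
      exact Finset.mem_erase.2 ⟨hne.symm, hf⟩
    · by_cases hge : g = e
      · subst hge
        exact Finset.mem_union_right _ (Finset.mem_erase.2 ⟨hyx, Sym2.mem_toFinset.2 hy⟩)
      · exact Finset.mem_union_left _ (Finset.mem_biUnion.2
          ⟨g, Finset.mem_erase.2 ⟨hge, hg⟩, Sym2.mem_toFinset.2 hy⟩)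
  have h1 : ((C.erase e).biUnion Sym2.toFinset).card ≤ (C.erase e).card * 2 :=
    Finset.card_biUnion_le_card_mul _ _ _ fun e _ => by
      rw [Sym2.card_toFinset]
      split_ifs <;> omega
  have h2 : (e.toFinset.erase x).card = 1 := by
    rw [Finset.card_erase_of_mem (Sym2.mem_toFinset.2 hxe),
      Sym2.card_toFinset_of_not_isDiag e (hdiag e he)]
  have h3 := (Finset.card_le_card huniv).trans (Finset.card_union_le _ _)
  rw [Finset.card_univ, ZMod.card, h2] at h3
  rw [Finset.card_erase_of_mem he] at h1
  have := Finset.card_pos.2 ⟨e, he⟩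
  omega

lemma IsPM.card_le {m : ℕ} (hm : 1 ≤ m) {M : Finset (Sym2 (Vtx m))} (hM : IsPM m M) :
    M.card ≤ m := by
  have : NeZero (2 * m) := ⟨by omega⟩
  have h1 : (M.biUnion Sym2.toFinset).card = M.card * 2 := by
    rw [Finset.card_biUnion, Finset.sum_const_nat]
    · exact fun e he => Sym2.card_toFinset_of_not_isDiag e (hM.1 e he)
    · intro e he f hf hne
      refine Finset.disjoint_left.2 fun x hxe hxf => ?_
      exact hM.2.1 e he f hf hne x (Sym2.mem_toFinset.1 hxe) (Sym2.mem_toFinset.1 hxf)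
  have h2 := Finset.card_le_univ (M.biUnion Sym2.toFinset)
  rw [h1, ZMod.card] at h2
  omega

/-- A set of edges meeting every blocker has an edge of odd order at every vertex. -/
lemma exists_odd_of_meets_blockers {m : ℕ} (hm : 1 ≤ m) {C : Finset (Sym2 (Vtx m))}
    (hC : ∀ B, IsBlocker m B → (C ∩ B).Nonempty) (x : Vtx m) :
    ∃ e ∈ C.filter fun e => Odd (edgeOrder m e), x ∈ e := by
  obtain ⟨v, -, -, rfl⟩ := exists_cast_eq hm 0 x
  obtain ⟨e, he⟩ := hC _ (isBlocker_doubleStar hm v (s := 0) (by omega))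
  rw [Finset.mem_inter] at he
  rcases exists_chord_of_mem_doubleStar he.2 with rfl | ⟨j, h1, h2, h3, rfl⟩ | ⟨j, h1, h2, rfl⟩
  · refine ⟨_, Finset.mem_filter.2 ⟨he.1, ?_⟩, left_mem_chord _ _ _⟩
    exact (odd_edgeOrder_chord (by omega) (by omega)).2 ⟨0, by ring⟩
  · omega
  · refine ⟨_, Finset.mem_filter.2 ⟨he.1, ?_⟩, left_mem_chord _ _ _⟩
    exact (odd_edgeOrder_chord (by omega) (by omega)).2 ⟨j, by ring⟩

lemma not_crosses_of_meets_blockers {m : ℕ} (hm : 1 ≤ m) {M : Finset (Sym2 (Vtx m))}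
    (hPM : IsPM m M) (hodd : ∀ e ∈ M, Odd (edgeOrder m e))
    (hM : ∀ B, IsBlocker m B → (M ∩ B).Nonempty) {v : ℤ} {e f : Sym2 (Vtx m)} (he : e ∈ M)
    (hf : f ∈ M) (hne : e ≠ f) (hve : (v : Vtx m) ∈ e) (hvf : ((v + 1 : ℤ) : Vtx m) ∈ f) :
    ¬ Crosses m e f ∧ ¬ Crosses m f e := by
  obtain ⟨q, h1, h2, rfl⟩ := exists_eq_chord hm (hPM.1 e he) hve
  obtain ⟨r, h3, h4, rfl⟩ := exists_eq_chord hm (hPM.1 f hf) hvf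
  have hve' : ∀ y, (y : Vtx m) ∈ chord m v q → (y : Vtx m) ∉ chord m (v + 1) r :=
    fun y => hPM.2.1 _ he _ hf hne y
  obtain ⟨c, hc⟩ := (odd_edgeOrder_chord h1 h2).1 (hodd _ he)
  obtain ⟨d, hd⟩ := (odd_edgeOrder_chord h3 h4).1 (hodd _ hf)
  have hq : q ≠ v + 1 := by
    rintro rfl
    exact hve' _ (right_mem_chord _ _ _) (left_mem_chord _ _ _)
  have hr : r ≠ v + 2 * m := by
    rintro rfl
    refine hve' v (left_mem_chord _ _ _) ?_
    rw [← cast_add_period]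
    exact right_mem_chord _ _ _
  rcases (by omega : r < q ∨ q < r) with h | h
  · refine ⟨not_crosses_chord_of_inside (by omega) (by omega) (by omega) (by omega) (by omega), ?_⟩
    rw [← chord_add_period m q v]
    exact not_crosses_chord_of_outside (by omega) (by omega) (by omega) (by omega) (by omega)
  · exfalso
    have hd0 : 0 ≤ d := by omega
    obtain ⟨g, hg⟩ := hM _ (isBlocker_doubleStar hm v (s := d.toNat) (by omega))
    rw [Finset.mem_inter] at hg
    obtain ⟨hgM, hg⟩ := hg
    rcases exists_chord_of_mem_doubleStar hg with rfl | ⟨j, h5, h6, h7, rfl⟩ | ⟨j, h5, h6, rfl⟩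
    · have := eq_of_cast_eq (hPM.cast_eq hgM he) (by omega) (by omega)
      omega
    · have := eq_of_cast_eq (hPM.cast_eq hgM hf) (by omega) (by omega)
      omega
    · have := eq_of_cast_eq (hPM.cast_eq hgM he) (by omega) (by omega)
      omega

/-- For every `m ≥ 1`, a set `M` of edges of `CGG(2m)` is a co-blocker if and
only if `M` is a semi-simple perfect matching. -/
theorem coBlocker_iff_semiSimple (m : ℕ) (hm : 1 ≤ m)
    (M : Finset (Sym2 (Vtx m))) :
    IsCoBlocker m M ↔ IsSemiSimple m M := by
  constructor
  · rintro ⟨hdiag, hmeet, hmin⟩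
    have hmeet : ∀ B, IsBlocker m B → (M ∩ B).Nonempty := hmeet
    have hcard : M.card ≤ m := by
      have hS := isSPM_stackSPM hm 0 le_rfl (by omega)
      refine (hmin _ hS.1.1 fun B hB => ?_).trans (hS.1.card_le hm)
      rw [Finset.inter_comm]
      exact hB.2.1 _ hS
    have hcover := exists_odd_of_meets_blockers hm hmeet
    have hfilter := Finset.eq_of_subset_of_card_le (Finset.filter_subset _ M)
      (hcard.trans (le_card_of_covers hm hcover))
    rw [hfilter] at hcover
    have hodd := Finset.filter_eq_self.1 hfilter
    have hPM := isPM_of_covers hm hdiag hcover hcard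
    refine ⟨hPM, hodd, ?_⟩
    rintro e he f hf hne ⟨x, hx, y, hy, hxy⟩
    obtain ⟨v, -, -, rfl⟩ := exists_cast_eq hm 0 x
    obtain ⟨w, -, -, rfl⟩ := exists_cast_eq hm 0 y
    rcases hxy with h | h
    · refine (not_crosses_of_meets_blockers hm hPM hodd hmeet hf he hne.symm hy ?_).2
      rwa [Int.cast_add, Int.cast_one, ← h]
    · refine (not_crosses_of_meets_blockers hm hPM hodd hmeet he hf hne hx ?_).1
      rwa [Int.cast_add, Int.cast_one, ← h]
  · intro hM
    refine ⟨hM.1.1, fun B hB => ?_, fun B' _ hB' => ?_⟩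
    · rw [Finset.inter_comm]
      exact IsBlocker.inter_nonempty hm hB hM
    · refine (hM.1.card_le hm).trans (le_card_of_covers hm fun x => ?_)
      obtain ⟨e, he, hx⟩ := exists_odd_of_meets_blockers hm hB' x
      exact ⟨e, (Finset.mem_filter.1 he).1, hx⟩
end

section
/- For every m ≥ 1, the number of co-blockers of CGG(2m) is at least ⌊m/3⌋! and at most m!. -/
/-- A fixed-point-free involution of `{0, …, n-1}` whose arcs do not interleave. -/
def NonCrossingInvolution (n : ℕ) (g : ℕ → ℕ) : Prop :=
  ∀ i < n, g i < n ∧ g (g i) = i ∧ g i ≠ i ∧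
    ∀ j, i < j → j < g i → i < g j ∧ g j < g i

lemma natCast_two_mul (m : ℕ) : ((2 * m : ℕ) : Vtx m) = 0 := ZMod.natCast_self _

lemma natCast_inj_of_lt {m i j : ℕ} (hi : i < 2 * m) (hj : j < 2 * m)
    (h : (i : Vtx m) = j) : i = j := by
  rw [ZMod.natCast_eq_natCast_iff'] at h
  rwa [Nat.mod_eq_of_lt hi, Nat.mod_eq_of_lt hj] at h

lemma exists_eq_add_natCast {m : ℕ} [NeZero m] (a x : Vtx m) :
    ∃ i < 2 * m, x = a + (i : Vtx m) :=
  ⟨(x - a).val, ZMod.val_lt _, by simp⟩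

lemma val_natCast_sub {m i j : ℕ} (hi : i < 2 * m) (hj : j < 2 * m) :
    ((j : Vtx m) - i).val = if i ≤ j then j - i else 2 * m + j - i := by
  split_ifs with h
  · rw [← Nat.cast_sub h, ZMod.val_natCast_of_lt (by omega)]
  · have : (j : Vtx m) - i = ((2 * m + j - i : ℕ) : Vtx m) := by
      rw [Nat.cast_sub (by omega), Nat.cast_add, natCast_two_mul, zero_add]
    rw [this, ZMod.val_natCast_of_lt (by omega)]

lemma inArc_add_natCast {m p q r : ℕ} (a : Vtx m) (hp : p < 2 * m) (hq : q < 2 * m)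
    (hr : r < 2 * m) :
    InArc m (a + p) (a + q) (a + r) ↔
      0 < (if p ≤ r then r - p else 2 * m + r - p) ∧
      (if p ≤ r then r - p else 2 * m + r - p) <
        (if p ≤ q then q - p else 2 * m + q - p) := by
  unfold InArc
  rw [add_sub_add_left_eq_sub, add_sub_add_left_eq_sub, val_natCast_sub hp hr,
    val_natCast_sub hp hq]

namespace NonCrossingInvolution

variable {m : ℕ} {g : ℕ → ℕ}

lemma inArc_iff (hg : NonCrossingInvolution (2 * m) g) (a : Vtx m) {p r : ℕ}
    (hp : p < 2 * m) (hr : r < 2 * m) (h1 : r ≠ p) (h2 : r ≠ g p) :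
    InArc m (a + p) (a + g p) (a + r) ↔ InArc m (a + p) (a + g p) (a + g r) := by
  obtain ⟨hp1, hp2, hp3, hp4⟩ := hg p hp
  obtain ⟨hr1, hr2, hr3, hr4⟩ := hg r hr
  obtain ⟨-, -, -, hq4⟩ := hg (g p) hp1
  rw [inArc_add_natCast a hp hp1 hr, inArc_add_natCast a hp hp1 hr1]
  have e1 := hp4 r
  have e2 := hp4 (g r)
  have e3 := hq4 r
  have e4 := hq4 (g r)
  rw [hr2] at e2 e4
  rw [hp2] at e3 e4
  have h3 : g r ≠ p := fun h => h2 (by rw [← h, hr2])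
  have h4 : g r ≠ g p := fun h => h1 (by rw [← hr2, h, hp2])
  split_ifs <;> omega

/-- The simple perfect matching of `CGG(2m)` obtained by placing a non-crossing involution
on the circle with starting point `a`. -/
lemma isSPM [NeZero m] (hg : NonCrossingInvolution (2 * m) g) (a : Vtx m) :
    IsSPM m ((Finset.range (2 * m)).image fun i : ℕ => s(a + (i : Vtx m), a + (g i : Vtx m))) := by
  have key : ∀ e ∈ (Finset.range (2 * m)).image
      (fun i : ℕ => s(a + (i : Vtx m), a + (g i : Vtx m))), ∀ x y : Vtx m, e = s(x, y) →
      ∃ i < 2 * m, x = a + (i : Vtx m) ∧ y = a + (g i : Vtx m) := by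
    intro e he x y hxy
    obtain ⟨i, hi, rfl⟩ := Finset.mem_image.1 he
    rw [Finset.mem_range] at hi
    rcases Sym2.eq_iff.1 hxy with ⟨rfl, rfl⟩ | ⟨rfl, rfl⟩
    · exact ⟨i, hi, rfl, rfl⟩
    · exact ⟨g i, (hg i hi).1, rfl, by rw [(hg i hi).2.1]⟩
  have ne_of : ∀ p < 2 * m, ∀ r < 2 * m,
      s(a + (p : Vtx m), a + (g p : Vtx m)) ≠ s(a + (r : Vtx m), a + (g r : Vtx m)) →
      r ≠ p ∧ r ≠ g p := by
    intro p hp r hr hne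
    refine ⟨fun h => hne (by rw [h]), fun h => hne ?_⟩
    rw [h, (hg p hp).2.1, Sym2.eq_swap]
  refine ⟨⟨?_, ?_, ?_⟩, ?_⟩
  · intro e he
    obtain ⟨i, hi, rfl⟩ := Finset.mem_image.1 he
    rw [Finset.mem_range] at hi
    rw [Sym2.mk_isDiag_iff]
    intro h
    exact (hg i hi).2.2.1 (natCast_inj_of_lt hi (hg i hi).1 (add_left_cancel h)).symm
  · intro e he f hf hne x hxe hxf
    obtain ⟨y, rfl⟩ := Sym2.mem_iff_exists.1 hxe
    obtain ⟨z, rfl⟩ := Sym2.mem_iff_exists.1 hxf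
    obtain ⟨i, hi, hx, rfl⟩ := key _ he _ _ rfl
    obtain ⟨j, hj, hx', rfl⟩ := key _ hf _ _ rfl
    have := natCast_inj_of_lt hi hj (add_left_cancel (hx.symm.trans hx'))
    subst this
    exact hne rfl
  · intro x
    obtain ⟨i, hi, rfl⟩ := exists_eq_add_natCast a x
    exact ⟨_, Finset.mem_image_of_mem _ (Finset.mem_range.2 hi), Sym2.mem_mk_left _ _⟩
  · rintro e he f hf hne ⟨x, y, z, w, hxy, hzw, hx⟩
    obtain ⟨p, hp, rfl, rfl⟩ := key _ he _ _ hxy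
    obtain ⟨r, hr, rfl, rfl⟩ := key _ hf _ _ hzw
    subst hxy hzw
    obtain ⟨h1, h2⟩ := ne_of p hp r hr hne
    rw [hg.inArc_iff a hp hr h1 h2] at hx
    exact (xor_self _).mp hx

lemma reflect (hg : NonCrossingInvolution (2 * m) g) :
    NonCrossingInvolution (2 * m) fun i => 2 * m - 1 - g (2 * m - 1 - i) := by
  intro i hi
  beta_reduce
  obtain ⟨h1, h2, h3, -⟩ := hg (2 * m - 1 - i) (by omega)
  have e : 2 * m - 1 - (2 * m - 1 - g (2 * m - 1 - i)) = g (2 * m - 1 - i) := by omega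
  refine ⟨by omega, by rw [e]; omega, by omega, fun j hij hj => ?_⟩
  obtain ⟨k1, k2, -, k4⟩ := hg (2 * m - 1 - j) (by omega)
  obtain ⟨-, -, -, h4⟩ := hg (g (2 * m - 1 - i)) h1
  have := h4 (2 * m - 1 - j) (by omega) (by omega)
  omega

end NonCrossingInvolution

/-- A set of edges meeting every simple perfect matching. -/
def MeetsAllSPM (m : ℕ) (B : Finset (Sym2 (Vtx m))) : Prop :=
  ∀ M, IsSPM m M → (B ∩ M).Nonempty

lemma MeetsAllSPM.exists_mem {m : ℕ} [NeZero m] {B : Finset (Sym2 (Vtx m))}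
    (hB : MeetsAllSPM m B) {g : ℕ → ℕ} (hg : NonCrossingInvolution (2 * m) g)
    (a : Vtx m) {ε : Vtx m} (hε : ε = 1 ∨ ε = -1) :
    ∃ i < 2 * m, s(a + ε * (i : Vtx m), a + ε * (g i : Vtx m)) ∈ B := by
  rcases hε with rfl | rfl
  · obtain ⟨e, he⟩ := hB _ (hg.isSPM a)
    rw [Finset.mem_inter, Finset.mem_image] at he
    obtain ⟨he, i, hi, rfl⟩ := he
    exact ⟨i, Finset.mem_range.1 hi, by simpa using he⟩
  · obtain ⟨e, he⟩ := hB _ (hg.reflect.isSPM (a + 1))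
    rw [Finset.mem_inter, Finset.mem_image] at he
    obtain ⟨he, i, hi, rfl⟩ := he
    rw [Finset.mem_range] at hi
    have cast_eq : ∀ j < 2 * m,
        a + 1 + ((2 * m - 1 - j : ℕ) : Vtx m) = a + -1 * (j : Vtx m) := by
      intro j hj
      rw [Nat.cast_sub (by omega), Nat.cast_sub (by omega), natCast_two_mul]
      push_cast
      ring
    refine ⟨2 * m - 1 - i, by omega, ?_⟩
    rw [← cast_eq _ (by omega), ← cast_eq _ (hg _ (by omega)).1]
    rwa [show 2 * m - 1 - (2 * m - 1 - i) = i by omega]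

section Blockers

variable {m : ℕ} [NeZero m] {B C : Finset (Sym2 (Vtx m))} {ε : Vtx m}

omit [NeZero m] in
lemma mk_mem_of_eq {x y x' y' : Vtx m} (h : s(x, y) ∈ B) (hx : x = x') (hy : y = y') :
    s(x', y') ∈ B := hx ▸ hy ▸ h

omit [NeZero m] in
lemma add_mul_natCast_inj (hε : ε = 1 ∨ ε = -1) (a : Vtx m) {i j : ℕ} (hi : i < 2 * m)
    (hj : j < 2 * m) : a + ε * (i : Vtx m) = a + ε * (j : Vtx m) ↔ i = j := by
  refine ⟨fun h => natCast_inj_of_lt hi hj ?_, fun h => by rw [h]⟩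
  rcases hε with rfl | rfl <;> simpa using h

omit [NeZero m] in
lemma edgeDir_mk (x y : Vtx m) : edgeDir m s(x, y) = x + y := rfl

/-- The reflection pairing positions whose sum is `2m - 1`. -/
lemma nonCrossingInvolution_parallel (m : ℕ) :
    NonCrossingInvolution (2 * m) fun i => 2 * m - 1 - i := by
  intro i hi
  beta_reduce
  refine ⟨by omega, by omega, by omega, fun j h1 h2 => by omega⟩

lemma MeetsAllSPM.exists_edgeDir_eq (hB : MeetsAllSPM m B) (i : ℕ) :
    ∃ e ∈ B, edgeDir m e = 2 * (i : Vtx m) + 1 := by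
  obtain ⟨j, hj, h⟩ := hB.exists_mem (nonCrossingInvolution_parallel m) ((i : Vtx m) + 1)
    (Or.inl rfl)
  refine ⟨_, h, ?_⟩
  rw [edgeDir_mk, Nat.cast_sub (by omega), Nat.cast_sub (by omega), natCast_two_mul]
  push_cast
  ring

lemma card_image_odd_directions (m : ℕ) [NeZero m] :
    ((Finset.range m).image fun i : ℕ => 2 * (i : Vtx m) + 1).card = m := by
  rw [Finset.card_image_of_injOn, Finset.card_range]
  intro i hi j hj h
  simp only [Finset.coe_range, Set.mem_Iio] at hi hj
  have := natCast_inj_of_lt (m := m) (i := 2 * i) (j := 2 * j) (by omega) (by omega)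
    (by push_cast; exact add_right_cancel h)
  omega

lemma MeetsAllSPM.odd_directions_subset (hB : MeetsAllSPM m B) :
    ((Finset.range m).image fun i : ℕ => 2 * (i : Vtx m) + 1) ⊆ B.image (edgeDir m) := by
  intro d hd
  obtain ⟨i, -, rfl⟩ := Finset.mem_image.1 hd
  exact Finset.mem_image.2 (hB.exists_edgeDir_eq i)

lemma MeetsAllSPM.le_card (hB : MeetsAllSPM m B) : m ≤ B.card := by
  have := Finset.card_le_card hB.odd_directions_subset
  rw [card_image_odd_directions] at this
  exact this.trans Finset.card_image_le

lemma MeetsAllSPM.edgeDir_injOn (hB : MeetsAllSPM m B) (hc : B.card ≤ m) :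
    Set.InjOn (edgeDir m) B := by
  have := Finset.card_le_card hB.odd_directions_subset
  rw [card_image_odd_directions] at this
  exact Finset.card_image_iff.1 (le_antisymm Finset.card_image_le (hc.trans this))

/-- Two edges of `B` of the same direction, given by their positions relative to `a`,
have the same pair of positions. -/
lemma MeetsAllSPM.pos_eq (hB : MeetsAllSPM m B) (hc : B.card ≤ m)
    (hε : ε = 1 ∨ ε = -1) {a : Vtx m} {i j p q : ℕ}
    (hi : i < 2 * m) (hj : j < 2 * m) (hp : p < 2 * m) (hq : q < 2 * m)
    (h1 : s(a + ε * (i : Vtx m), a + ε * (j : Vtx m)) ∈ B)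
    (h2 : s(a + ε * (p : Vtx m), a + ε * (q : Vtx m)) ∈ B)
    (hd : i + j = p + q ∨ i + j = 2 * m + (p + q)) :
    (i = p ∧ j = q) ∨ (i = q ∧ j = p) := by
  have hd' : (i : Vtx m) + j = p + q := by
    rcases hd with h | h
    · exact_mod_cast congrArg (Nat.cast (R := Vtx m)) h
    · have := congrArg (Nat.cast (R := Vtx m)) h
      rw [Nat.cast_add, Nat.cast_add (2 * m), natCast_two_mul, zero_add] at this
      exact_mod_cast this
  have := hB.edgeDir_injOn hc h1 h2 (by
    rw [edgeDir_mk, edgeDir_mk]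
    linear_combination ε * hd')
  rw [Sym2.eq_iff] at this
  rwa [add_mul_natCast_inj hε a hi hp, add_mul_natCast_inj hε a hj hq,
    add_mul_natCast_inj hε a hi hq, add_mul_natCast_inj hε a hj hp] at this

omit [NeZero m] in
lemma nonCrossingInvolution_flip (hm : 2 ≤ m) : NonCrossingInvolution (2 * m) fun i =>
    if i = 0 then 1 else if i = 1 then 0 else if i = 2 then 3 else if i = 3 then 2
    else 2 * m + 3 - i := by
  intro i hi
  beta_reduce
  refine ⟨?_, ?_, ?_, fun j h1 h2 => ?_⟩ <;> grind

/-- A vertex both of whose boundary edges belong to `B`. -/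
def IsCenter {m : ℕ} (B : Finset (Sym2 (Vtx m))) (v : Vtx m) : Prop :=
  s(v, v + 1) ∈ B ∧ s(v, v - 1) ∈ B

omit [NeZero m] in
lemma isCenter_iff (hε : ε = 1 ∨ ε = -1) (v : Vtx m) :
    IsCenter B v ↔ s(v, v + ε) ∈ B ∧ s(v, v - ε) ∈ B := by
  rcases hε with rfl | rfl
  · rfl
  · rw [IsCenter, and_comm, sub_neg_eq_add, ← sub_eq_add_neg]

lemma MeetsAllSPM.isCenter_or (hB : MeetsAllSPM m B) (hc : B.card ≤ m) (hm : 2 ≤ m)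
    (hε : ε = 1 ∨ ε = -1) {v : Vtx m} (h : s(v, v + ε) ∈ B) :
    IsCenter B v ∨ IsCenter B (v + ε) := by
  have h' : s(v - ε + ε * ((1 : ℕ) : Vtx m), v - ε + ε * ((2 : ℕ) : Vtx m)) ∈ B := by
    refine mk_mem_of_eq h ?_ ?_ <;> push_cast <;> ring
  rw [isCenter_iff hε, isCenter_iff hε]
  have h01 : s(v - ε + ε * ((0 : ℕ) : Vtx m), v - ε + ε * ((1 : ℕ) : Vtx m)) ∈ B →
      s(v, v - ε) ∈ B := by
    intro k
    rw [Sym2.eq_swap]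
    refine mk_mem_of_eq k ?_ ?_ <;> push_cast <;> ring
  have h23 : s(v - ε + ε * ((2 : ℕ) : Vtx m), v - ε + ε * ((3 : ℕ) : Vtx m)) ∈ B →
      s(v + ε, v + ε + ε) ∈ B := by
    intro k
    refine mk_mem_of_eq k ?_ ?_ <;> push_cast <;> ring
  have hs : s(v + ε, v + ε - ε) ∈ B := by
    rw [Sym2.eq_swap]; simpa using h
  obtain ⟨i, hi, hiB⟩ := hB.exists_mem (nonCrossingInvolution_flip hm) (v - ε) hε
  by_cases i0 : i = 0
  · subst i0; exact Or.inl ⟨h, h01 (by simpa using hiB)⟩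
  by_cases i1 : i = 1
  · subst i1; exact Or.inl ⟨h, h01 (by rw [Sym2.eq_swap]; simpa using hiB)⟩
  by_cases i2 : i = 2
  · subst i2; exact Or.inr ⟨h23 (by simpa using hiB), hs⟩
  by_cases i3 : i = 3
  · subst i3; exact Or.inr ⟨h23 (by rw [Sym2.eq_swap]; simpa using hiB), hs⟩
  · simp only [i0, i1, i2, i3, if_false] at hiB
    have := hB.pos_eq hc hε hi (by omega) (by omega) (by omega) hiB h' (by omega)
    omega

lemma nonCrossingInvolution_boundary (m : ℕ) : NonCrossingInvolution (2 * m) fun i =>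
    if i % 2 = 0 then i + 1 else i - 1 := by
  intro i hi
  beta_reduce
  refine ⟨?_, ?_, ?_, fun j h1 h2 => ?_⟩ <;> grind

lemma MeetsAllSPM.exists_isCenter (hB : MeetsAllSPM m B) (hc : B.card ≤ m) (hm : 2 ≤ m) :
    ∃ v, IsCenter B v := by
  obtain ⟨i, hi, h⟩ := hB.exists_mem (nonCrossingInvolution_boundary m) 0 (Or.inl rfl)
  have : ∃ v : Vtx m, s(v, v + 1) ∈ B := by
    simp only [zero_add, one_mul] at h
    split_ifs at h with hpar
    · exact ⟨i, by simpa using h⟩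
    · refine ⟨((i - 1 : ℕ) : Vtx m), ?_⟩
      rw [Sym2.eq_swap, ← Nat.cast_succ, show (i - 1).succ = i by omega]
      exact h
  obtain ⟨v, hv⟩ := this
  rcases hB.isCenter_or hc hm (Or.inl rfl) hv with h | h
  exacts [⟨_, h⟩, ⟨_, h⟩]

omit [NeZero m] in
lemma nonCrossingInvolution_left {t : ℕ} (ht : t % 2 = 1) (htm : t + 5 ≤ 2 * m) :
    NonCrossingInvolution (2 * m) fun i =>
      if i ≤ t + 2 then t + 2 - i else if i = 2 * m - 2 then 2 * m - 1
      else if i = 2 * m - 1 then 2 * m - 2 else 2 * m + t - i := by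
  generalize hg : (fun i => _ : ℕ → ℕ) = g
  have spec : ∀ i, (i ≤ t + 2 ∧ g i = t + 2 - i) ∨ (i = 2 * m - 2 ∧ g i = 2 * m - 1) ∨
      (i = 2 * m - 1 ∧ g i = 2 * m - 2) ∨
      (t + 2 < i ∧ i ≠ 2 * m - 2 ∧ i ≠ 2 * m - 1 ∧ g i = 2 * m + t - i) := by
    intro i
    rw [← hg]
    grind
  clear hg
  intro i hi
  have hgg := spec (g i)
  rcases spec i with h | h | h | h <;>
    refine ⟨by omega, by omega, by omega, fun j h1 h2 => ?_⟩ <;>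
    rcases spec j with h' | h' | h' | h' <;> omega

omit [NeZero m] in
lemma nonCrossingInvolution_right {t : ℕ} (ht : t % 2 = 1) (htm : t + 5 ≤ 2 * m) :
    NonCrossingInvolution (2 * m) fun i =>
      if i = 0 then t + 2 else if i < t then t - i else if i = t then t + 1
      else if i = t + 1 then t else if i = t + 2 then 0 else 2 * m + t + 2 - i := by
  generalize hg : (fun i => _ : ℕ → ℕ) = g
  have spec : ∀ i, (i = 0 ∧ g i = t + 2) ∨ (0 < i ∧ i < t ∧ g i = t - i) ∨
      (i = t ∧ g i = t + 1) ∨ (i = t + 1 ∧ g i = t) ∨ (i = t + 2 ∧ g i = 0) ∨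
      (t + 2 < i ∧ g i = 2 * m + t + 2 - i) := by
    intro i
    rw [← hg]
    grind
  clear hg
  intro i hi
  have hgg := spec (g i)
  rcases spec i with h | h | h | h | h | h <;>
    refine ⟨by omega, by omega, by omega, fun j h1 h2 => ?_⟩ <;>
    rcases spec j with h' | h' | h' | h' | h' | h' <;> omega

lemma MeetsAllSPM.step (hB : MeetsAllSPM m B) (hc : B.card ≤ m)
    (hε : ε = 1 ∨ ε = -1) {a : Vtx m} {t : ℕ} (ht : t % 2 = 1) (htm : t + 5 ≤ 2 * m)
    (h : s(a, a + ε * (t : Vtx m)) ∈ B) (h1 : s(a - ε, a - 2 * ε) ∉ B)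
    (h2 : s(a + ε * (t : Vtx m), a + ε * ((t + 1 : ℕ) : Vtx m)) ∉ B) :
    s(a, a + ε * ((t + 2 : ℕ) : Vtx m)) ∈ B := by
  have h0 : s(a + ε * ((0 : ℕ) : Vtx m), a + ε * (t : Vtx m)) ∈ B := by simpa using h
  have h1' : s(a + ε * ((2 * m - 1 : ℕ) : Vtx m), a + ε * ((2 * m - 2 : ℕ) : Vtx m)) ∉ B := by
    rw [Nat.cast_sub (by omega), Nat.cast_sub (by omega), natCast_two_mul]
    refine fun h => h1 (mk_mem_of_eq h ?_ ?_) <;> push_cast <;> ring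
  obtain ⟨i, hi, hiB⟩ := hB.exists_mem (nonCrossingInvolution_left ht htm) a hε
  obtain ⟨j, hj, hjB⟩ := hB.exists_mem (nonCrossingInvolution_right ht htm) a hε
  have hi2 : i ≤ t + 2 := by
    by_contra hlt
    rw [if_neg hlt] at hiB
    split_ifs at hiB with c1 c2
    · subst c1; rw [Sym2.eq_swap] at hiB; exact h1' hiB
    · subst c2; exact h1' hiB
    · have := hB.pos_eq hc hε hi (by omega) (by omega) (by omega) hiB h0 (by omega)
      omega
  rw [if_pos hi2] at hiB
  split_ifs at hjB with c1 c2 c3 c4 c5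
  · subst c1; simpa using hjB
  · have := hB.pos_eq hc hε hj (by omega) (by omega) (by omega) hjB h0 (by omega)
    omega
  · subst c3; exact absurd hjB h2
  · subst c4; rw [Sym2.eq_swap] at hjB; exact absurd hjB h2
  · subst c5; rw [Sym2.eq_swap] at hjB; simpa using hjB
  · have := hB.pos_eq hc hε hj (by omega) hi (by omega) hjB hiB (by omega)
    omega

/-- Among any three consecutive boundary edges, one belongs to `C`. -/
def MeetsBoundaryTriples (C : Finset (Sym2 (Vtx m))) : Prop :=
  ∀ x : Vtx m, s(x, x + 1) ∈ C ∨ s(x + 1, x + 2) ∈ C ∨ s(x + 2, x + 3) ∈ C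

omit [NeZero m] in
lemma IsCenter.notMem (hC : MeetsBoundaryTriples C) (hBC : Disjoint B C)
    (hε : ε = 1 ∨ ε = -1) {v : Vtx m} (hv : IsCenter B v) : s(v - ε, v - 2 * ε) ∉ B := by
  obtain ⟨hv1, hv2⟩ := hv
  intro h
  have hd : ∀ e ∈ B, e ∉ C := fun e he => Finset.disjoint_left.1 hBC he
  rcases hε with rfl | rfl
  · rcases hC (v - 2) with k | k | k
    · refine hd _ h ?_
      rw [Sym2.eq_swap]
      refine mk_mem_of_eq k ?_ ?_ <;> ring
    · refine hd _ hv2 ?_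
      rw [Sym2.eq_swap]
      refine mk_mem_of_eq k ?_ ?_ <;> ring
    · refine hd _ hv1 ?_
      refine mk_mem_of_eq k ?_ ?_ <;> ring
  · rcases hC (v - 1) with k | k | k
    · refine hd _ hv2 ?_
      rw [Sym2.eq_swap]
      refine mk_mem_of_eq k ?_ ?_ <;> ring
    · refine hd _ hv1 ?_
      refine mk_mem_of_eq k ?_ ?_ <;> ring
    · refine hd _ h ?_
      refine mk_mem_of_eq k ?_ ?_ <;> ring

/-- Starting from a center `a`, the edges from `a` to every second vertex belong to `B`
as long as no other center is passed. -/
lemma MeetsAllSPM.chain (hB : MeetsAllSPM m B) (hc : B.card ≤ m) (hm : 2 ≤ m)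
    (hC : MeetsBoundaryTriples C) (hBC : Disjoint B C) (hε : ε = 1 ∨ ε = -1)
    {a : Vtx m} (ha : IsCenter B a) (k : ℕ) (hk : 2 * k + 1 < 2 * m)
    (hno : ∀ p, 0 < p → p < 2 * k + 1 → ¬ IsCenter B (a + ε * (p : Vtx m))) :
    s(a, a + ε * ((2 * k + 1 : ℕ) : Vtx m)) ∈ B := by
  have ha' := (isCenter_iff hε a).1 ha
  induction k with
  | zero => simpa using ha'.1
  | succ k ih =>
    by_cases hlast : 2 * (k + 1) + 1 = 2 * m - 1
    · rw [hlast, Nat.cast_sub (by omega), natCast_two_mul]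
      refine mk_mem_of_eq ha'.2 ?_ ?_ <;> push_cast <;> ring
    · refine hB.step hc hε (t := 2 * k + 1) (by omega) (by omega)
        (ih (by omega) fun p h1 h2 => hno p h1 (by omega)) (ha.notMem hC hBC hε) fun h => ?_
      have e : a + ε * ((2 * k + 1 + 1 : ℕ) : Vtx m) = a + ε * ((2 * k + 1 : ℕ) : Vtx m) + ε := by
        push_cast; ring
      rw [e] at h
      rcases hB.isCenter_or hc hm hε h with h | h
      · exact hno _ (by omega) (by omega) h
      · rw [← e] at h
        exact hno _ (by omega) (by omega) h

/-- The set contains an edge of odd order at every vertex. -/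
def MeetsStars (C : Finset (Sym2 (Vtx m))) : Prop :=
  ∀ v : Vtx m, ∃ k < m, s(v, v + ((2 * k + 1 : ℕ) : Vtx m)) ∈ C

lemma MeetsAllSPM.false_of_two_centers (hB : MeetsAllSPM m B) (hc : B.card ≤ m) (hm : 2 ≤ m)
    (hC : MeetsBoundaryTriples C) (hBC : Disjoint B C) (hε : ε = 1 ∨ ε = -1)
    {a : Vtx m} (ha : IsCenter B a) {p : ℕ} (hp : 0 < p) (hpm : p ≤ m)
    (hap : IsCenter B (a + ε * (p : Vtx m))) : False := by
  classical
  have hε' : -ε = 1 ∨ -ε = -1 := by rcases hε with rfl | rfl <;> simp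
  have h01 : s(a + ε * ((0 : ℕ) : Vtx m), a + ε * ((1 : ℕ) : Vtx m)) ∈ B := by
    simpa using ((isCenter_iff hε a).1 ha).1
  let P : ℕ → Prop := fun i => IsCenter B (a + ε * (i : Vtx m))
  have hex : ∃ i, m < i ∧ P i := by
    refine ⟨2 * m, by omega, ?_⟩
    simp only [P]
    rwa [natCast_two_mul, mul_zero, add_zero]
  obtain ⟨q, hqm, hPq, hmax⟩ : ∃ q ≤ m, P q ∧ ∀ r, q < r → r ≤ m → ¬ P r :=
    ⟨Nat.findGreatest P m, Nat.findGreatest_le m, Nat.findGreatest_spec hpm hap,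
      fun r h1 h2 => Nat.findGreatest_is_greatest h1 h2⟩
  have hpq : p ≤ q := by
    by_contra h
    exact hmax p (by omega) hpm hap
  obtain ⟨r, hrm, hPr, hmin⟩ : ∃ r, m < r ∧ P r ∧ ∀ i, m < i → i < r → ¬ P i :=
    ⟨Nat.find hex, (Nat.find_spec hex).1, (Nat.find_spec hex).2,
      fun i h1 h2 h3 => Nat.find_min hex h2 ⟨h1, h3⟩⟩
  have hr2 : r ≤ 2 * m := by
    by_contra h
    refine hmin (2 * m) (by omega) (by omega) ?_
    simp only [P]
    rwa [natCast_two_mul, mul_zero, add_zero]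
  have hno : ∀ i, q < i → i < r → ¬ P i := by
    intro i h1 h2
    by_cases h : i ≤ m
    · exact hmax i h1 h
    · exact hmin i (by omega) h2
  have hq1 : q ≠ 1 := by
    rintro rfl
    refine IsCenter.notMem hC hBC hε' ha ?_
    have := ((isCenter_iff hε _).1 hPq).1
    refine mk_mem_of_eq this ?_ ?_ <;> push_cast <;> ring
  by_cases hqr : 2 * m + 1 ≤ q + r
  · have h := hB.chain hc hm hC hBC hε hPq (m - q) (by omega) (by
      intro i h1 h2
      have := hno (q + i) (by omega) (by omega)
      simp only [P] at this
      rwa [Nat.cast_add, mul_add, ← add_assoc] at this)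
    rw [add_assoc, ← mul_add, ← Nat.cast_add] at h
    have := hB.pos_eq hc hε (by omega) (by omega) (by omega) (by omega) h h01 (by omega)
    omega
  · have h := hB.chain hc hm hC hBC hε' hPr (r - m - 1) (by omega) (by
      intro i h1 h2
      have := hno (r - i) (by omega) (by omega)
      simp only [P] at this
      rw [Nat.cast_sub (by omega)] at this
      convert this using 2
      ring)
    have e : a + ε * (r : Vtx m) + -ε * ((2 * (r - m - 1) + 1 : ℕ) : Vtx m) =
        a + ε * ((2 * m + 1 - r : ℕ) : Vtx m) := by
      have : ((2 * (r - m - 1) + 1 : ℕ) : Vtx m) + ((2 * m + 1 - r : ℕ) : Vtx m) = r := by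
        rw [← Nat.cast_add]
        congr 1
        omega
      linear_combination (-ε) * this
    rw [e] at h
    have := hB.pos_eq hc hε (by omega) (by omega) (by omega) (by omega) h h01 (by omega)
    omega

theorem MeetsAllSPM.inter_nonempty (hB : MeetsAllSPM m B) (hc : B.card ≤ m)
    (hC : MeetsBoundaryTriples C) (hS : MeetsStars C) : (B ∩ C).Nonempty := by
  rw [← Finset.not_disjoint_iff_nonempty_inter]
  intro hBC
  by_cases hm : 2 ≤ m
  · obtain ⟨v, hv⟩ := hB.exists_isCenter hc hm
    by_cases hw : ∃ p, 0 < p ∧ p < 2 * m ∧ IsCenter B (v + 1 * (p : Vtx m))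
    · obtain ⟨p, hp, hpm, hvp⟩ := hw
      by_cases hle : p ≤ m
      · exact hB.false_of_two_centers hc hm hC hBC (Or.inl rfl) hv hp hle hvp
      · refine hB.false_of_two_centers hc hm hC hBC (Or.inr rfl) hv (p := 2 * m - p)
          (by omega) (by omega) ?_
        rw [Nat.cast_sub hpm.le, natCast_two_mul]
        convert hvp using 2
        ring
    · push Not at hw
      obtain ⟨k, hk, hkC⟩ := hS v
      have := hB.chain hc hm hC hBC (Or.inl rfl) hv k (by omega)
        fun p h1 h2 => hw p h1 (by omega)
      rw [one_mul] at this
      exact Finset.disjoint_left.1 hBC this hkC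
  · have hm1 : m = 1 := by have := NeZero.pos m; omega
    subst hm1
    obtain ⟨i, hi, h⟩ := hB.exists_mem (nonCrossingInvolution_parallel 1) 0 (Or.inl rfl)
    obtain ⟨k, hk, hkC⟩ := hS ((i : ℕ) : Vtx 1)
    refine Finset.disjoint_left.1 hBC h ?_
    obtain rfl : k = 0 := by omega
    convert hkC using 2
    · simp
    · have : i = 0 ∨ i = 1 := by omega
      rcases this with rfl | rfl
      · simp
      · simp only [zero_add, one_mul]; rfl

end Blockers

section Stars

variable {m : ℕ} [NeZero m] {M B C : Finset (Sym2 (Vtx m))}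

lemma even_card_of_involution {α : Type*} [DecidableEq α] {A : Finset α} {p : α → α}
    (hA : ∀ x ∈ A, p x ∈ A) (hp : ∀ x, p (p x) = x) (hne : ∀ x, p x ≠ x) : Even A.card := by
  rw [even_iff_two_dvd, ← CharP.cast_eq_zero_iff (ZMod 2) 2]
  have : ∑ _x ∈ A, (1 : ZMod 2) = 0 :=
    Finset.sum_involution (fun x _ => p x) (fun _ _ => by decide) (fun x _ _ => hne x)
      (fun x hx => hA x hx) (fun x _ => hp x)
  simpa using this

/-- Every edge of a simple perfect matching has odd order. -/
lemma IsSPM.meetsStars (hM : IsSPM m M) : MeetsStars M := by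
  classical
  obtain ⟨⟨hdiag, hdisj, hcov⟩, hcross⟩ := hM
  have hpart : ∀ x : Vtx m, ∃ y, s(x, y) ∈ M := by
    intro x
    obtain ⟨e, he, hx⟩ := hcov x
    obtain ⟨y, rfl⟩ := Sym2.mem_iff_exists.1 hx
    exact ⟨y, he⟩
  choose p hp using hpart
  have huniq : ∀ x y, s(x, y) ∈ M → y = p x := by
    intro x y h
    by_contra hne
    exact hdisj _ h _ (hp x) (fun e => hne (Sym2.congr_right.1 e)) x (Sym2.mem_mk_left _ _)
      (Sym2.mem_mk_left _ _)
  have hpp : ∀ x, p (p x) = x := fun x => (huniq _ _ (Sym2.eq_swap ▸ hp x)).symm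
  have hne : ∀ x, p x ≠ x := fun x h => hdiag _ (hp x) (Sym2.mk_isDiag_iff.2 h.symm)
  intro v
  obtain ⟨t, ht, htv⟩ := exists_eq_add_natCast v (p v)
  have hiff : ∀ i < 2 * m, InArc m v (p v) (v + (i : Vtx m)) ↔ 0 < i ∧ i < t := by
    intro i hi
    have := inArc_add_natCast v (p := 0) (by omega) ht hi
    rw [Nat.cast_zero, add_zero, ← htv] at this
    simpa using this
  have hcard : (Finset.univ.filter fun x => InArc m v (p v) x).card = t - 1 := by
    have : (Finset.univ.filter fun x => InArc m v (p v) x) =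
        (Finset.Ioo 0 t).image fun i : ℕ => v + (i : Vtx m) := by
      ext x
      obtain ⟨i, hi, rfl⟩ := exists_eq_add_natCast v x
      simp only [Finset.mem_filter, Finset.mem_univ, true_and, hiff i hi, Finset.mem_image,
        Finset.mem_Ioo]
      refine ⟨fun h => ⟨i, h, rfl⟩, ?_⟩
      rintro ⟨j, hj, e⟩
      rwa [← natCast_inj_of_lt (by omega) hi (add_left_cancel e)]
    rw [this, Finset.card_image_of_injOn, Nat.card_Ioo]
    · rfl
    · intro i hi j hj e
      simp only [Finset.coe_Ioo, Set.mem_Ioo] at hi hj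
      exact natCast_inj_of_lt (by omega) (by omega) (add_left_cancel e)
  have heven : Even (Finset.univ.filter fun x => InArc m v (p v) x).card := by
    refine even_card_of_involution (p := p) (fun x hx => ?_) hpp hne
    rw [Finset.mem_filter] at hx ⊢
    refine ⟨Finset.mem_univ _, ?_⟩
    by_contra hx'
    refine hcross _ (hp v) _ (hp x) (fun e => ?_)
      ⟨v, p v, x, p x, rfl, rfl, Or.inl ⟨hx.2, hx'⟩⟩
    rcases Sym2.eq_iff.1 e with ⟨rfl, -⟩ | ⟨-, rfl⟩
    · simpa [InArc] using hx.2
    · simpa [InArc] using hx.2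
  have ht0 : t ≠ 0 := by
    rintro rfl
    exact hne v (by simpa using htv)
  rw [hcard] at heven
  obtain ⟨k, hk⟩ := heven
  refine ⟨k, by omega, ?_⟩
  rw [show 2 * k + 1 = t by omega, ← htv]
  exact hp v

/-- The edges of odd order at the vertex `v`. -/
def oddStar (m : ℕ) (v : Vtx m) : Finset (Sym2 (Vtx m)) :=
  (Finset.range m).image fun k : ℕ => s(v, v + ((2 * k + 1 : ℕ) : Vtx m))

omit [NeZero m] in
lemma card_oddStar_le (v : Vtx m) : (oddStar m v).card ≤ m :=
  Finset.card_image_le.trans (Finset.card_range m).le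

omit [NeZero m] in
lemma not_isDiag_of_mem_oddStar {v : Vtx m} {e : Sym2 (Vtx m)} (he : e ∈ oddStar m v) :
    ¬ e.IsDiag := by
  obtain ⟨k, hk, rfl⟩ := Finset.mem_image.1 he
  rw [Finset.mem_range] at hk
  rw [Sym2.mk_isDiag_iff, left_eq_add, ← Nat.cast_zero]
  intro h
  have := natCast_inj_of_lt (by omega) (by omega) h
  omega

lemma meetsAllSPM_oddStar (v : Vtx m) : MeetsAllSPM m (oddStar m v) := by
  intro M hM
  obtain ⟨k, hk, h⟩ := hM.meetsStars v
  exact ⟨_, Finset.mem_inter.2 ⟨Finset.mem_image_of_mem _ (Finset.mem_range.2 hk), h⟩⟩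

lemma isBlocker_oddStar (v : Vtx m) : IsBlocker m (oddStar m v) :=
  ⟨fun _ => not_isDiag_of_mem_oddStar, meetsAllSPM_oddStar v,
    fun _ _ h => (card_oddStar_le v).trans (MeetsAllSPM.le_card h)⟩

lemma IsBlocker.card_le (hB : IsBlocker m B) : B.card ≤ m :=
  (hB.2.2 _ (fun _ => not_isDiag_of_mem_oddStar) (meetsAllSPM_oddStar 0)).trans (card_oddStar_le 0)

lemma meetsStars_of_meets_blockers (hC : ∀ B, IsBlocker m B → (C ∩ B).Nonempty) :
    MeetsStars C := by
  intro v
  obtain ⟨e, he⟩ := hC _ (isBlocker_oddStar v)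
  obtain ⟨heC, he⟩ := Finset.mem_inter.1 he
  obtain ⟨k, hk, rfl⟩ := Finset.mem_image.1 he
  exact ⟨k, Finset.mem_range.1 hk, heC⟩

/-- The edges joining each even vertex `2i` to the odd vertex `2s(i)+1`. -/
def bipartiteEdges (m : ℕ) (s : ℕ → ℕ) : Finset (Sym2 (Vtx m)) :=
  (Finset.range m).image fun i : ℕ => s(((2 * i : ℕ) : Vtx m), ((2 * s i + 1 : ℕ) : Vtx m))

omit [NeZero m] in
lemma evenOdd_edge_inj {i j i' j' : ℕ} (hi : i < m) (hj : j < m) (hi' : i' < m) (hj' : j' < m)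
    (h : s(((2 * i : ℕ) : Vtx m), ((2 * j + 1 : ℕ) : Vtx m)) =
      s(((2 * i' : ℕ) : Vtx m), ((2 * j' + 1 : ℕ) : Vtx m))) : i = i' ∧ j = j' := by
  rcases Sym2.eq_iff.1 h with ⟨h1, h2⟩ | ⟨h1, h2⟩
  · have := natCast_inj_of_lt (by omega) (by omega) h1
    have := natCast_inj_of_lt (by omega) (by omega) h2
    omega
  · have := natCast_inj_of_lt (by omega) (by omega) h1
    omega

omit [NeZero m] in
lemma card_bipartiteEdges {s : ℕ → ℕ} (hs : ∀ i < m, s i < m) :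
    (bipartiteEdges m s).card = m := by
  rw [bipartiteEdges, Finset.card_image_of_injOn, Finset.card_range]
  intro i hi j hj h
  simp only [Finset.coe_range, Set.mem_Iio] at hi hj
  exact (evenOdd_edge_inj hi (hs i hi) hj (hs j hj) h).1

omit [NeZero m] in
lemma mem_bipartiteEdges_iff {s : ℕ → ℕ} (hs : ∀ i < m, s i < m) {i j : ℕ} (hi : i < m)
    (hj : j < m) :
    s(((2 * i : ℕ) : Vtx m), ((2 * j + 1 : ℕ) : Vtx m)) ∈ bipartiteEdges m s ↔ s i = j := by
  refine ⟨fun h => ?_, ?_⟩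
  · obtain ⟨i', hi', h⟩ := Finset.mem_image.1 h
    rw [Finset.mem_range] at hi'
    obtain ⟨rfl, rfl⟩ := evenOdd_edge_inj hi' (hs i' hi') hi hj h
    rfl
  · rintro rfl
    exact Finset.mem_image_of_mem _ (Finset.mem_range.2 hi)

omit [NeZero m] in
lemma natCast_two_mul_mod (n : ℕ) : ((2 * (n % m) : ℕ) : Vtx m) = ((2 * n : ℕ) : Vtx m) := by
  rw [ZMod.natCast_eq_natCast_iff']
  rw [← Nat.mul_mod_mul_left, Nat.mod_mod]

/-- A set with an edge of odd order at every vertex contains a bipartite edge set. -/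
lemma MeetsStars.exists_bipartiteEdges_subset (hC : MeetsStars C) :
    ∃ s : ℕ → ℕ, (∀ i, s i < m) ∧ bipartiteEdges m s ⊆ C := by
  choose k hk hkC using fun i : ℕ => hC ((2 * i : ℕ) : Vtx m)
  refine ⟨fun i => (i + k i) % m, fun i => Nat.mod_lt _ (NeZero.pos m), fun e he => ?_⟩
  obtain ⟨i, -, rfl⟩ := Finset.mem_image.1 he
  refine mk_mem_of_eq (hkC i) rfl ?_
  rw [Nat.cast_add (2 * ((i + k i) % m)), natCast_two_mul_mod]
  push_cast
  ring

lemma MeetsStars.surjOn {s : ℕ → ℕ} (hs : ∀ i < m, s i < m)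
    (hC : MeetsStars (bipartiteEdges m s)) {j : ℕ} (hj : j < m) : ∃ i < m, s i = j := by
  obtain ⟨k, hk, h⟩ := hC ((2 * j + 1 : ℕ) : Vtx m)
  have hlt : (j + k + 1) % m < m := Nat.mod_lt _ (NeZero.pos m)
  refine ⟨(j + k + 1) % m, hlt, (mem_bipartiteEdges_iff hs hlt hj).1 ?_⟩
  rw [Sym2.eq_swap]
  refine mk_mem_of_eq h rfl ?_
  rw [natCast_two_mul_mod]
  push_cast
  ring

lemma meetsStars_bipartiteEdges {s : ℕ → ℕ} (hs : ∀ i < m, s i < m)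
    (hsurj : ∀ j < m, ∃ i < m, s i = j) : MeetsStars (bipartiteEdges m s) := by
  have hmem : ∀ i < m,
      s(((2 * i : ℕ) : Vtx m), ((2 * s i + 1 : ℕ) : Vtx m)) ∈ bipartiteEdges m s :=
    fun i hi => (mem_bipartiteEdges_iff hs hi (hs i hi)).2 rfl
  have cast_shift : ∀ a b n : ℕ, a + n = b ∨ a + n = 2 * m + b →
      (b : Vtx m) = (a : Vtx m) + (n : Vtx m) := by
    rintro a b n (h | h)
    · rw [← h, Nat.cast_add]
    · rw [← Nat.cast_add, h, Nat.cast_add, natCast_two_mul, zero_add]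
  intro v
  obtain ⟨n, hn, rfl⟩ := exists_eq_add_natCast 0 v
  rw [zero_add]
  obtain ⟨i, rfl | rfl⟩ : ∃ i, n = 2 * i ∨ n = 2 * i + 1 := ⟨n / 2, by omega⟩
  · have := hs i (by omega)
    refine ⟨if i ≤ s i then s i - i else m + s i - i, by split_ifs <;> omega,
      mk_mem_of_eq (hmem i (by omega)) rfl (cast_shift _ _ _ ?_)⟩
    split_ifs <;> omega
  · obtain ⟨j, hj, rfl⟩ := hsurj i (by omega)
    have := hs j hj
    refine ⟨if s j < j then j - s j - 1 else m + j - s j - 1, by split_ifs <;> omega,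
      mk_mem_of_eq (Sym2.eq_swap ▸ hmem j hj) rfl (cast_shift _ _ _ ?_)⟩
    split_ifs <;> omega

lemma isCoBlocker_bipartiteEdges {s : ℕ → ℕ} (hs : ∀ i < m, s i < m)
    (hsurj : ∀ j < m, ∃ i < m, s i = j) (h3 : MeetsBoundaryTriples (bipartiteEdges m s)) :
    IsCoBlocker m (bipartiteEdges m s) := by
  refine ⟨fun e he => ?_, fun B hB => ?_, fun C _ hC => ?_⟩
  · obtain ⟨i, hi, rfl⟩ := Finset.mem_image.1 he
    rw [Finset.mem_range] at hi
    rw [Sym2.mk_isDiag_iff]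
    intro h
    have := hs i hi
    have := natCast_inj_of_lt (by omega) (by omega) h
    omega
  · rw [Finset.inter_comm]
    exact MeetsAllSPM.inter_nonempty hB.2.1 (IsBlocker.card_le hB) h3
      (meetsStars_bipartiteEdges hs hsurj)
  · obtain ⟨s', hs', hsub⟩ :=
      (meetsStars_of_meets_blockers hC).exists_bipartiteEdges_subset
    rw [card_bipartiteEdges hs]
    exact (card_bipartiteEdges fun i _ => hs' i).ge.trans (Finset.card_le_card hsub)

end Stars

section Counting

/-- Extend a self-map of `{0, …, k-1}` to the natural numbers. -/
def extendFin {k : ℕ} (f : Fin k → Fin k) (n : ℕ) : ℕ :=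
  if h : n < k then f ⟨n, h⟩ else n

lemma extendFin_lt {k : ℕ} (f : Fin k → Fin k) {n : ℕ} (h : n < k) : extendFin f n < k := by
  rw [extendFin, dif_pos h]
  exact (f ⟨n, h⟩).2

/-- The permutation of `{0, …, m-1}` whose bipartite edges are the boundary edges
`{3i+1, 3i+2}` for `i < 2k`, the long edges `{6i, 6t(i)+3}` for `i < k`, and the boundary
edges `{2i, 2i+1}` for `3k ≤ i < m`. -/
def tripleMap (k : ℕ) (t : ℕ → ℕ) (n : ℕ) : ℕ :=
  if n < 3 * k then
    if n % 3 = 0 then 3 * t (n / 3) + 1 else if n % 3 = 1 then n - 1 else n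
  else n

variable {m k : ℕ} {t : ℕ → ℕ}

lemma tripleMap_lt (hk : 3 * k ≤ m) (ht : ∀ i < k, t i < k) {n : ℕ} (hn : n < m) :
    tripleMap k t n < m := by
  have := ht (n / 3)
  unfold tripleMap
  split_ifs <;> omega

lemma tripleMap_surj (hk : 3 * k ≤ m) (hsurj : ∀ j < k, ∃ i < k, t i = j) {j : ℕ} (hj : j < m) :
    ∃ i < m, tripleMap k t i = j := by
  by_cases h : j < 3 * k
  · by_cases h1 : j % 3 = 1
    · obtain ⟨i, hi, hij⟩ := hsurj (j / 3) (by omega)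
      refine ⟨3 * i, by omega, ?_⟩
      rw [tripleMap, if_pos (by omega), if_pos (by omega), Nat.mul_div_cancel_left _ (by omega),
        hij]
      omega
    · by_cases h0 : j % 3 = 0
      · refine ⟨j + 1, by omega, ?_⟩
        unfold tripleMap
        split_ifs <;> omega
      · refine ⟨j, hj, ?_⟩
        unfold tripleMap
        split_ifs <;> omega
  · exact ⟨j, hj, if_neg h⟩

lemma boundary_mem_of_lt (hk : 3 * k ≤ m) (ht : ∀ i < k, t i < k) {b : ℕ}
    (hb : (b < 6 * k ∧ b % 3 = 1) ∨ (6 * k ≤ b ∧ b < 2 * m ∧ b % 2 = 0)) :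
    s((b : Vtx m), (b : Vtx m) + 1) ∈ bipartiteEdges m (tripleMap k t) := by
  have hs : ∀ n < m, tripleMap k t n < m := fun n hn => tripleMap_lt hk ht hn
  by_cases hpar : b % 2 = 0
  · have h : tripleMap k t (b / 2) = b / 2 := by
      unfold tripleMap
      split_ifs <;> omega
    have := (mem_bipartiteEdges_iff hs (i := b / 2) (j := b / 2) (by omega) (by omega)).2 h
    rw [show 2 * (b / 2) = b by omega] at this
    exact mk_mem_of_eq this rfl (Nat.cast_succ b)
  · have h : tripleMap k t ((b + 1) / 2) = b / 2 := by
      unfold tripleMap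
      split_ifs <;> omega
    have := (mem_bipartiteEdges_iff hs (i := (b + 1) / 2) (j := b / 2) (by omega) (by omega)).2 h
    rw [show 2 * (b / 2) + 1 = b by omega, show 2 * ((b + 1) / 2) = b + 1 by omega,
      Sym2.eq_swap] at this
    exact mk_mem_of_eq this rfl (Nat.cast_succ b)

lemma meetsBoundaryTriples_tripleMap [NeZero m] (hk : 3 * k ≤ m) (ht : ∀ i < k, t i < k) :
    MeetsBoundaryTriples (bipartiteEdges m (tripleMap k t)) := by
  intro x
  obtain ⟨n, hn, rfl⟩ := exists_eq_add_natCast 0 x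
  rw [zero_add]
  have key : ∀ i < 3, ∀ b : ℕ, n + i = b ∨ n + i = 2 * m + b →
      ((b < 6 * k ∧ b % 3 = 1) ∨ (6 * k ≤ b ∧ b < 2 * m ∧ b % 2 = 0)) →
      s((n : Vtx m) + (i : Vtx m), (n : Vtx m) + (i : Vtx m) + 1) ∈
        bipartiteEdges m (tripleMap k t) := by
    intro i _ b hb hb'
    have e : (b : Vtx m) = (n : Vtx m) + (i : Vtx m) := by
      rw [← Nat.cast_add]
      rcases hb with h | h
      · rw [h]
      · rw [h, Nat.cast_add, natCast_two_mul, zero_add]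
    exact e ▸ boundary_mem_of_lt hk ht hb'
  have hcase : ∃ i < 3, ∃ b : ℕ, (n + i = b ∨ n + i = 2 * m + b) ∧
      ((b < 6 * k ∧ b % 3 = 1) ∨ (6 * k ≤ b ∧ b < 2 * m ∧ b % 2 = 0)) := by
    by_cases h0 : (n < 6 * k ∧ n % 3 = 1) ∨ (6 * k ≤ n ∧ n % 2 = 0)
    · exact ⟨0, by omega, n, by omega, by omega⟩
    by_cases h1 : n + 1 < 2 * m ∧
        ((n + 1 < 6 * k ∧ (n + 1) % 3 = 1) ∨ (6 * k ≤ n + 1 ∧ (n + 1) % 2 = 0))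
    · exact ⟨1, by omega, n + 1, by omega, by omega⟩
    by_cases h2 : n + 2 < 2 * m
    · exact ⟨2, by omega, n + 2, by omega, by omega⟩
    by_cases hk0 : k = 0
    · exact ⟨1, by omega, 0, by omega, by omega⟩
    · exact ⟨2, by omega, 1, by omega, by omega⟩
  obtain ⟨i, hi, b, hb, hb'⟩ := hcase
  have := key i hi b hb hb'
  interval_cases i
  · left; simpa using this
  · right; left; refine mk_mem_of_eq this ?_ ?_ <;> push_cast <;> ring
  · right; right; refine mk_mem_of_eq this ?_ ?_ <;> push_cast <;> ring

lemma isCoBlocker_tripleMap [NeZero m] (hk : 3 * k ≤ m) (τ : Equiv.Perm (Fin k)) :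
    IsCoBlocker m (bipartiteEdges m (tripleMap k (extendFin τ))) := by
  have ht : ∀ i < k, extendFin τ i < k := fun i hi => extendFin_lt τ hi
  refine isCoBlocker_bipartiteEdges (fun i hi => tripleMap_lt hk ht hi)
    (fun j hj => tripleMap_surj hk (fun i hi => ?_) hj) (meetsBoundaryTriples_tripleMap hk ht)
  refine ⟨τ.symm ⟨i, hi⟩, (τ.symm ⟨i, hi⟩).2, ?_⟩
  simp [extendFin]

lemma bipartiteEdges_tripleMap_injective (hk : 3 * k ≤ m) :
    Function.Injective fun τ : Equiv.Perm (Fin k) =>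
      bipartiteEdges m (tripleMap k (extendFin τ)) := by
  intro τ τ' h
  have ht : ∀ τ : Equiv.Perm (Fin k), ∀ i < m, tripleMap k (extendFin τ) i < m :=
    fun τ i hi => tripleMap_lt hk (fun i hi => extendFin_lt τ hi) hi
  ext i
  have h3 : ∀ τ : Equiv.Perm (Fin k), tripleMap k (extendFin τ) (3 * i) = 3 * (τ i : ℕ) + 1 := by
    intro τ
    rw [tripleMap, if_pos (by omega), if_pos (by omega), Nat.mul_div_cancel_left _ (by omega),
      extendFin, dif_pos i.2]
  have hi : 3 * (i : ℕ) < m := by omega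
  have hmem := (mem_bipartiteEdges_iff (ht τ) hi (ht τ _ hi)).2 rfl
  beta_reduce at h
  rw [h] at hmem
  have := (mem_bipartiteEdges_iff (ht τ') hi (ht τ _ hi)).1 hmem
  rw [h3, h3] at this
  omega

lemma IsCoBlocker.exists_perm [NeZero m] {C : Finset (Sym2 (Vtx m))} (hC : IsCoBlocker m C) :
    ∃ σ : Equiv.Perm (Fin m), bipartiteEdges m (extendFin σ) = C := by
  have hstars := meetsStars_of_meets_blockers hC.2.1
  obtain ⟨s, hs, hsub⟩ := hstars.exists_bipartiteEdges_subset
  have hD := isCoBlocker_tripleMap (Nat.zero_le m) (1 : Equiv.Perm (Fin 0))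
  have hcard : C.card ≤ m := (hC.2.2 _ hD.1 hD.2.1).trans
    (Finset.card_image_le.trans (Finset.card_range m).le)
  have heq : bipartiteEdges m s = C :=
    Finset.eq_of_subset_of_card_le hsub (by rwa [card_bipartiteEdges fun i _ => hs i])
  rw [← heq] at hstars
  have hsurj : Function.Surjective fun i : Fin m => (⟨s i, hs i⟩ : Fin m) := by
    intro j
    obtain ⟨i, hi, hij⟩ := hstars.surjOn (fun i _ => hs i) j.2
    exact ⟨⟨i, hi⟩, Fin.ext hij⟩
  refine ⟨Equiv.ofBijective _ (Finite.surjective_iff_bijective.1 hsurj), ?_⟩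
  rw [← heq]
  refine Finset.image_congr fun i hi => ?_
  simp only [Finset.coe_range, Set.mem_Iio] at hi
  simp [extendFin, hi]

end Counting

/-- For every `m ≥ 1`, the number of co-blockers of `CGG(2m)` is at least
`⌊m/3⌋!` and at most `m!`. -/
theorem card_coBlockers_bounds (m : ℕ) (hm : 1 ≤ m) :
    Nat.factorial (m / 3) ≤
        Nat.card {C : Finset (Sym2 (Vtx m)) // IsCoBlocker m C} ∧
      Nat.card {C : Finset (Sym2 (Vtx m)) // IsCoBlocker m C} ≤
        Nat.factorial m := by
  have : NeZero m := ⟨by omega⟩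
  constructor
  · have hk : 3 * (m / 3) ≤ m := by omega
    have hle := Nat.card_le_card_of_injective
      (fun τ : Equiv.Perm (Fin (m / 3)) =>
        (⟨_, isCoBlocker_tripleMap hk τ⟩ : {C : Finset (Sym2 (Vtx m)) // IsCoBlocker m C}))
      fun τ τ' h => bipartiteEdges_tripleMap_injective hk (congrArg Subtype.val h)
    rwa [Nat.card_eq_fintype_card, Fintype.card_perm, Fintype.card_fin] at hle
  · choose σ hσ using fun C : {C : Finset (Sym2 (Vtx m)) // IsCoBlocker m C} =>
      C.2.exists_perm
    have hle := Nat.card_le_card_of_injective σ fun C C' h =>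
      Subtype.ext (by rw [← hσ C, ← hσ C', h])
    rwa [Nat.card_eq_fintype_card (α := Equiv.Perm (Fin m)), Fintype.card_perm,
      Fintype.card_fin] at hle
end

section
/- Let M be a semi-simple perfect matching of CGG(2m) and let {a,b} ∈ M be an interior edge (an edge of order > 1). Then each of the two open cyclic arcs determined by a and b contains both endpoints of some boundary edge belonging to M. -/
theorem IsPM.ne_zero {m : ℕ} {M : Finset (Sym2 (Vtx m))} (hM : IsPM m M) : m ≠ 0 := by
  rintro rfl
  have hfin : (⋃ e ∈ M, (e : Set (Vtx 0))).Finite :=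
    M.finite_toSet.biUnion fun e _ => by
      induction e using Sym2.ind with
      | _ x y => rw [Sym2.coe_mk]; exact Set.toFinite _
  have huniv : (⋃ e ∈ M, (e : Set (Vtx 0))) = Set.univ := by
    ext x
    simpa using hM.2.2 x
  rw [huniv] at hfin
  exact Set.infinite_univ (α := ℤ) hfin

theorem ZMod.val_sub_eq_val_sub_add_one {n : ℕ} (hn : 1 < n) (a x : ZMod n) (hx : x ≠ a) :
    (x - a).val = (x - (a + 1)).val + 1 := by
  have : Fact (1 < n) := ⟨hn⟩
  have : NeZero n := ⟨by lia⟩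
  have hpos : 0 < (x - a).val := by
    rw [Nat.pos_iff_ne_zero, Ne, ZMod.val_eq_zero, sub_eq_zero]
    exact hx
  have h := ZMod.val_sub (a := x - a) (b := 1) (by rw [ZMod.val_one]; exact hpos)
  rw [ZMod.val_one, sub_sub] at h
  lia

/-- A semi-simple perfect matching has a boundary edge strictly inside every arc of length
greater than one that is spanned by one of its edges. -/
theorem IsSemiSimple.exists_boundary_inArc {m : ℕ} {M : Finset (Sym2 (Vtx m))}
    (hM : IsSemiSimple m M) (a b : Vtx m) (hab : s(a, b) ∈ M) (h : 1 < (b - a).val) :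
    ∃ f ∈ M, edgeOrder m f = 1 ∧ ∀ v ∈ f, InArc m a b v := by
  have hm : 1 < 2 * m := by have := hM.1.ne_zero; lia
  have : Fact (1 < 2 * m) := ⟨hm⟩
  have : NeZero (2 * m) := ⟨by lia⟩
  induction hn : (b - a).val using Nat.strong_induction_on generalizing a b with
  | _ n ih =>
    have hsucc : InArc m a b (a + 1) := by
      rw [InArc, add_sub_cancel_left, ZMod.val_one]
      exact ⟨one_pos, h⟩
    have hne_a : a + 1 ≠ a := by simp
    have hne_b : a + 1 ≠ b := by rintro rfl; exact lt_irrefl _ hsucc.2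
    obtain ⟨e, heM, he⟩ := hM.1.2.2 (a + 1)
    obtain ⟨c, rfl⟩ := Sym2.mem_iff_exists.mp he
    have hc : InArc m a b c := by
      by_contra hc
      refine hM.2.2 _ hab _ heM ?_ ⟨a, Sym2.mem_mk_left _ _, a + 1, he, Or.inr rfl⟩
        ⟨a, b, a + 1, c, rfl, rfl, Or.inl ⟨hsucc, hc⟩⟩
      intro heq
      rw [← heq, Sym2.mem_iff] at he
      tauto
    have hca : c ≠ a := by rintro rfl; simp [InArc] at hc
    have hcs : c ≠ a + 1 := by rintro rfl; exact hM.1.1 _ heM rfl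
    have hval := ZMod.val_sub_eq_val_sub_add_one hm a c hca
    have hpos : 0 < (c - (a + 1)).val := by
      rw [Nat.pos_iff_ne_zero, Ne, ZMod.val_eq_zero, sub_eq_zero]
      exact hcs
    by_cases hone : (c - (a + 1)).val = 1
    · refine ⟨_, heM, ?_, ?_⟩
      · have hpos' : 0 < (a + 1 - c).val := by
          rw [Nat.pos_iff_ne_zero, Ne, ZMod.val_eq_zero, sub_eq_zero]
          exact hcs.symm
        change min (a + 1 - c).val (c - (a + 1)).val = 1
        lia
      · intro v hv
        rcases Sym2.mem_iff.mp hv with rfl | rfl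
        exacts [hsucc, hc]
    · have hlt := hc.2
      obtain ⟨f, hfM, hf, hfarc⟩ := ih (c - (a + 1)).val (by lia) (a + 1) c heM (by lia) rfl
      refine ⟨f, hfM, hf, fun v hv => ?_⟩
      obtain ⟨hv₀, hv₁⟩ := hfarc v hv
      have hva : v ≠ a := by
        rintro rfl
        have hmax : (v - (v + 1)).val + 1 = 2 * m := by
          rw [sub_add_cancel_left]
          have := ZMod.neg_val (1 : ZMod (2 * m))
          rw [if_neg one_ne_zero, ZMod.val_one] at this
          lia
        have := ZMod.val_lt (c - (v + 1))
        lia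
      have := ZMod.val_sub_eq_val_sub_add_one hm a v hva
      exact ⟨by lia, by lia⟩

/-- If `M` is a semi-simple perfect matching of `CGG(2m)` and `{a,b} ∈ M` is an
interior edge (order `> 1`), then each of the two open cyclic arcs determined by
`a` and `b` contains both endpoints of some boundary edge of `M`. -/
theorem semiSimple_boundary_edge_in_each_halfplane (m : ℕ)
    (M : Finset (Sym2 (Vtx m))) (hM : IsSemiSimple m M)
    (a b : Vtx m) (hab : s(a, b) ∈ M) (hord : 1 < edgeOrder m s(a, b)) :
    (∃ f ∈ M, edgeOrder m f = 1 ∧ ∀ v ∈ f, InArc m a b v) ∧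
    (∃ f ∈ M, edgeOrder m f = 1 ∧ ∀ v ∈ f, InArc m b a v) := by
  obtain ⟨hord₁, hord₂⟩ := lt_min_iff.mp hord
  exact ⟨hM.exists_boundary_inArc a b hab hord₂,
    hM.exists_boundary_inArc b a (Sym2.eq_swap ▸ hab) hord₁⟩
end

section
/- For every m ≥ 1 and every vertex x of CGG(2m), the set of all edges of odd order incident to x (which has exactly m elements) is a blocker of CGG(2m). -/
/-- The order of an edge `{a,b}` is odd exactly when the cyclic distance from `a` to `b` is. -/
theorem odd_edgeOrder_mk {m : ℕ} [NeZero (2 * m)] (a b : Vtx m) :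
    Odd (edgeOrder m s(a, b)) ↔ Odd (b - a).val := by
  change Odd (min (a - b).val (b - a).val) ↔ _
  have hneg : (a - b).val = if b - a = 0 then 0 else 2 * m - (b - a).val := by
    rw [← neg_sub b a, ZMod.neg_val]
  have hlt := ZMod.val_lt (b - a)
  split_ifs at hneg with h
  · simp [h]
  · simp only [Nat.odd_iff]
    omega

/-- The open arc from `a` to `b` contains one vertex less than the cyclic distance. -/
theorem card_filter_inArc {m : ℕ} [NeZero (2 * m)] (a b : Vtx m)
    [DecidablePred (InArc m a b)] :
    (Finset.univ.filter (InArc m a b)).card = (b - a).val - 1 := by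
  trans (Finset.Ioo 0 (b - a).val).card
  swap
  · rw [Nat.card_Ioo, Nat.sub_zero]
  refine Finset.card_bij (fun z _ => (z - a).val) ?_ ?_ ?_
  · intro z hz
    simpa [InArc] using hz
  · intro z _ w _ h
    exact sub_left_injective (ZMod.val_injective _ h)
  · intro n hn
    rw [Finset.mem_Ioo] at hn
    have hv : ((n : ℕ) : Vtx m).val = n :=
      ZMod.val_cast_of_lt (hn.2.trans (ZMod.val_lt _))
    refine ⟨a + n, ?_, ?_⟩
    · simpa [InArc, hv] using hn
    · simp [hv]

/-- Every edge of a simple perfect matching has odd order. -/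
theorem IsSPM.odd_edgeOrder {m : ℕ} [NeZero (2 * m)] {M : Finset (Sym2 (Vtx m))}
    (hM : IsSPM m M) {e : Sym2 (Vtx m)} (he : e ∈ M) : Odd (edgeOrder m e) := by
  classical
  obtain ⟨⟨hdiag, hdisj, hcov⟩, hcross⟩ := hM
  have hpartner : ∀ z : Vtx m, ∃ w, s(z, w) ∈ M := by
    intro z
    obtain ⟨f, hf, hz⟩ := hcov z
    obtain ⟨w, rfl⟩ := Sym2.mem_iff_exists.1 hz
    exact ⟨w, hf⟩
  choose g hg using hpartner
  have hgg : ∀ z, g (g z) = z := by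
    intro z
    by_contra hne
    refine hdisj _ (hg z) _ (hg (g z)) ?_ (g z) (Sym2.mem_mk_right _ _) (Sym2.mem_mk_left _ _)
    rw [Sym2.eq_swap, Ne, Sym2.congr_right]
    exact fun h => hne h.symm
  have hgne : ∀ z, g z ≠ z := fun z h => hdiag _ (hg z) (by simp [h])
  induction e with | _ a b => ?_
  rw [odd_edgeOrder_mk]
  have hpos : 0 < (b - a).val := by
    rw [ZMod.val_pos, sub_ne_zero]
    rintro rfl
    exact hdiag _ he (by simp)
  have hmem : ∀ z, InArc m a b z → InArc m a b (g z) := by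
    intro z hz
    have hne : s(a, b) ≠ s(z, g z) := by
      intro h
      have hz' : z ∈ s(a, b) := h ▸ Sym2.mem_mk_left _ _
      rcases Sym2.mem_iff.1 hz' with rfl | rfl
      · simp [InArc] at hz
      · exact lt_irrefl _ hz.2
    by_contra hw
    exact hcross _ he _ (hg z) hne ⟨a, b, z, g z, rfl, rfl, Or.inl ⟨hz, hw⟩⟩
  have hsum : ∑ _z ∈ Finset.univ.filter (InArc m a b), (1 : ZMod 2) = 0 :=
    Finset.sum_involution (fun z _ => g z) (fun _ _ => by decide) (fun z _ _ => hgne z)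
      (fun z hz => by simpa using hmem z (by simpa using hz)) (fun z _ => hgg z)
  rw [Finset.sum_const, nsmul_one, card_filter_inArc, ZMod.natCast_eq_zero_iff_even] at hsum
  rw [Nat.even_iff] at hsum
  rw [Nat.odd_iff]
  omega

/-- Edges of the same direction do not cross. -/
theorem not_crosses_of_edgeDir_eq {m : ℕ} [NeZero (2 * m)] {e f : Sym2 (Vtx m)}
    (h : edgeDir m e = edgeDir m f) : ¬ Crosses m e f := by
  have key : ∀ a b c d : Vtx m, a + b = c + d → InArc m a b c → InArc m a b d := by
    intro a b c d hs hc
    have hd : d - a = (b - a) - (c - a) := by linear_combination -hs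
    have hv := ZMod.val_sub hc.2.le
    rw [← hd] at hv
    have := hc.1
    have := hc.2
    unfold InArc
    omega
  rintro ⟨a, b, c, d, rfl, rfl, hx⟩
  replace h : a + b = c + d := h
  rcases hx with ⟨hc, hd⟩ | ⟨hd, hc⟩
  · exact hd (key a b c d h hc)
  · exact hc (key a b d c (h.trans (add_comm c d)) hd)

/-- The edges of a given odd direction form a simple perfect matching. -/
theorem isSPM_filter_edgeDir {m : ℕ} [NeZero (2 * m)] (k : ℕ) :
    IsSPM m (Finset.univ.filter fun e => edgeDir m e = ((2 * k + 1 : ℕ) : Vtx m)) := by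
  have hnd : ∀ z : Vtx m, z + z ≠ ((2 * k + 1 : ℕ) : Vtx m) := by
    intro z hz
    have h2 := congrArg (ZMod.castHom (dvd_mul_right 2 m) (ZMod 2)) hz
    rw [map_add, map_natCast, CharTwo.add_self_eq_zero, eq_comm,
      ZMod.natCast_eq_zero_iff_even, Nat.even_iff] at h2
    omega
  refine ⟨⟨?_, ?_, ?_⟩, ?_⟩
  · intro e he hd
    induction e with | _ a b => ?_
    rw [Finset.mem_filter] at he
    obtain rfl : a = b := hd
    exact hnd a he.2
  · intro e he f hf hne z hze hzf
    obtain ⟨v, rfl⟩ := Sym2.mem_iff_exists.1 hze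
    obtain ⟨w, rfl⟩ := Sym2.mem_iff_exists.1 hzf
    rw [Finset.mem_filter] at he hf
    have hvw : z + v = z + w := he.2.trans hf.2.symm
    exact hne (by rw [add_left_cancel hvw])
  · intro z
    refine ⟨s(z, ((2 * k + 1 : ℕ) : Vtx m) - z), ?_, Sym2.mem_mk_left _ _⟩
    rw [Finset.mem_filter]
    exact ⟨Finset.mem_univ _, add_sub_cancel z _⟩
  · intro e he f hf _
    rw [Finset.mem_filter] at he hf
    exact not_crosses_of_edgeDir_eq (he.2.trans hf.2.symm)

/-- The residues of distinct odd numbers below `2 * m` are distinct vertices. -/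
theorem injOn_natCast_two_mul_add_one (m : ℕ) :
    Set.InjOn (fun k : ℕ => ((2 * k + 1 : ℕ) : Vtx m)) (Finset.range m) := by
  intro i hi j hj h
  rw [Finset.mem_coe, Finset.mem_range] at hi hj
  have h' := congrArg ZMod.val h
  rw [ZMod.val_cast_of_lt (by omega), ZMod.val_cast_of_lt (by omega)] at h'
  omega

/-- Any set of edges meeting every simple perfect matching has at least `m` elements. -/
theorem le_card_of_meets_isSPM {m : ℕ} [NeZero (2 * m)] {B : Finset (Sym2 (Vtx m))}
    (hB : ∀ M, IsSPM m M → (B ∩ M).Nonempty) : m ≤ B.card := by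
  choose f hf using fun k => hB _ (isSPM_filter_edgeDir k)
  simp only [Finset.mem_inter, Finset.mem_filter, Finset.mem_univ, true_and] at hf
  refine (Finset.card_range m).ge.trans (Finset.card_le_card_of_injOn f (fun k _ => (hf k).1) ?_)
  intro i hi j hj h
  refine injOn_natCast_two_mul_add_one m hi hj ?_
  exact (hf i).2.symm.trans ((congrArg (edgeDir m) h).trans (hf j).2)

/-- There are `m` edges of odd order incident to a given vertex. -/
theorem card_odd_star {m : ℕ} [NeZero (2 * m)] (x : Vtx m) (S : Finset (Sym2 (Vtx m)))
    (hS : ∀ e : Sym2 (Vtx m), e ∈ S ↔ x ∈ e ∧ Odd (edgeOrder m e)) : S.card = m := by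
  refine Eq.trans (Eq.symm ?_) (Finset.card_range m)
  refine Finset.card_bij (fun k _ => s(x, x + ((2 * k + 1 : ℕ) : Vtx m))) ?_ ?_ ?_
  · intro k hk
    rw [Finset.mem_range] at hk
    rw [hS, odd_edgeOrder_mk, add_sub_cancel_left, ZMod.val_cast_of_lt (by omega)]
    exact ⟨Sym2.mem_mk_left _ _, odd_two_mul_add_one k⟩
  · intro i hi j hj h
    rw [Sym2.congr_right] at h
    exact injOn_natCast_two_mul_add_one m hi hj (add_left_cancel h)
  · intro e he
    obtain ⟨hx, ho⟩ := (hS e).1 he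
    obtain ⟨y, rfl⟩ := Sym2.mem_iff_exists.1 hx
    obtain ⟨k, hk⟩ := (odd_edgeOrder_mk x y).1 ho
    have hlt := ZMod.val_lt (y - x)
    refine ⟨k, Finset.mem_range.2 (by omega), ?_⟩
    rw [← hk, ZMod.natCast_zmod_val, add_sub_cancel]

/-- For every `m ≥ 1` and every vertex `x` of `CGG(2m)`, the set of all edges of
odd order incident to `x` has exactly `m` elements and is a blocker ("star
blocker"). -/
theorem star_is_blocker (m : ℕ) (hm : 1 ≤ m) (x : Vtx m)
    (S : Finset (Sym2 (Vtx m)))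
    (hS : ∀ e : Sym2 (Vtx m), e ∈ S ↔ x ∈ e ∧ Odd (edgeOrder m e)) :
    S.card = m ∧ IsBlocker m S := by
  have : NeZero (2 * m) := ⟨by omega⟩
  have hcard := card_odd_star x S hS
  refine ⟨hcard, ?_, ?_, ?_⟩
  · intro e he hd
    induction e with | _ a b => ?_
    obtain rfl : a = b := hd
    simpa [odd_edgeOrder_mk] using ((hS _).1 he).2
  · intro M hM
    obtain ⟨e, he, hx⟩ := hM.1.2.2 x
    exact ⟨e, Finset.mem_inter.2 ⟨(hS e).2 ⟨hx, IsSPM.odd_edgeOrder hM he⟩, he⟩⟩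
  · intro B _ hB
    rw [hcard]
    exact le_card_of_meets_isSPM hB
end
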